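/- arXiv:2010.10304 — 2 statements merged into one kernel-verified Lean document; each statement's English description precedes it below -/
import Mathlib

section
/- Let Γ be a countable amenable group all of whose finite dimensional unitary representations are trivial (i.e., every group homomorphism Γ → U(n), for every n, is the constant map to the identity). Then Γ is uniformly HS stable. -/
open scoped Matrix

/-- Normalized Hilbert–Schmidt norm: ‖A‖_{HS,n} = ((1/n)·Tr(A Aᴴ))^{1/2}. -/
noncomputable def hsNorm {n m : ℕ} (A : Matrix (Fin n) (Fin m) ℂ) : ℝ :=
  Real.sqrt ((1 / (n : ℝ)) * (Matrix.trace (A * Aᴴ)).re)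

/-- Operator norm (largest singular value) of a rectangular complex matrix. -/
noncomputable def opNorm {n m : ℕ} (A : Matrix (Fin n) (Fin m) ℂ) : ℝ :=
  ‖LinearMap.toContinuousLinearMap (Matrix.toEuclideanLin A)‖

/-- Γ is uniformly HS stable: for every δ>0 there is ε>0 such that every
ε-homomorphism into some U(n) (w.r.t. the normalized HS metric) is δ-close to a
genuine unitary representation of the same dimension. -/
def UniformlyHSStable (Γ : Type*) [Group Γ] : Prop :=
  ∀ δ : ℝ, 0 < δ → ∃ ε : ℝ, 0 < ε ∧
    ∀ (n : ℕ) (φ : Γ → Matrix.unitaryGroup (Fin n) ℂ),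
      (∀ g h : Γ, hsNorm ((φ g : Matrix (Fin n) (Fin n) ℂ) * (φ h : Matrix (Fin n) (Fin n) ℂ)
        - (φ (g * h) : Matrix (Fin n) (Fin n) ℂ)) < ε) →
      ∃ π : Γ →* Matrix.unitaryGroup (Fin n) ℂ,
        ∀ g : Γ, hsNorm ((φ g : Matrix (Fin n) (Fin n) ℂ) - (π g : Matrix (Fin n) (Fin n) ℂ)) < δ

/-- A unitary representation is irreducible if ℂⁿ has no nonzero proper invariant subspace. -/
def IsIrreducibleRep {Γ : Type*} [Group Γ] {n : ℕ}
    (π : Γ →* Matrix.unitaryGroup (Fin n) ℂ) : Prop :=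
  ∀ W : Submodule ℂ (Fin n → ℂ),
    (∀ g : Γ, ∀ v ∈ W, Matrix.mulVec (π g : Matrix (Fin n) (Fin n) ℂ) v ∈ W) →
    W = ⊥ ∨ W = ⊤

/-- Residual finiteness: every nonidentity element avoids some finite index normal subgroup. -/
def ResiduallyFinite (Γ : Type*) [Group Γ] : Prop :=
  ∀ x : Γ, x ≠ 1 → ∃ N : Subgroup Γ, N.Normal ∧ N.FiniteIndex ∧ x ∉ N

/-- Virtually abelian: there is an abelian subgroup of finite index. -/
def VirtuallyAbelian (Γ : Type*) [Group Γ] : Prop :=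
  ∃ A : Subgroup Γ, A.FiniteIndex ∧ ∀ x ∈ A, ∀ y ∈ A, x * y = y * x

/-- Amenability: a finitely additive, left-invariant probability measure on all subsets. -/
def IsAmenable (Γ : Type*) [Group Γ] : Prop :=
  ∃ μ : Set Γ → ℝ,
    (∀ S : Set Γ, 0 ≤ μ S) ∧
    μ Set.univ = 1 ∧
    (∀ S T : Set Γ, Disjoint S T → μ (S ∪ T) = μ S + μ T) ∧
    (∀ (g : Γ) (S : Set Γ), μ ((fun x => g * x) '' S) = μ S)

/-- Bounded functions with values in a normed space, as a real subspace of all functions. -/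
def boundedFun (Γ K : Type*) [NormedAddCommGroup K] [NormedSpace ℝ K] :
    Submodule ℝ (Γ → K) where
  carrier := {f | ∃ C : ℝ, ∀ x, ‖f x‖ ≤ C}
  add_mem' := by
    rintro f g ⟨C, hC⟩ ⟨D, hD⟩
    exact ⟨C + D, fun x => (norm_add_le _ _).trans (add_le_add (hC x) (hD x))⟩
  zero_mem' := ⟨0, fun x => by simp⟩
  smul_mem' := by
    rintro c f ⟨C, hC⟩
    refine ⟨‖c‖ * C, fun x => ?_⟩
    rw [Pi.smul_apply, norm_smul]
    exact mul_le_mul_of_nonneg_left (hC x) (norm_nonneg _)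

/-- A left-invariant mean on the bounded real functions on a group; its values at unbounded
functions are irrelevant. -/
structure IsInvariantMean {Γ : Type*} [Group Γ] (m : (Γ → ℝ) → ℝ) : Prop where
  add : ∀ f g, f ∈ boundedFun Γ ℝ → g ∈ boundedFun Γ ℝ → m (f + g) = m f + m g
  smul : ∀ (c : ℝ) (f), f ∈ boundedFun Γ ℝ → m (c • f) = c * m f
  nonneg : ∀ f, f ∈ boundedFun Γ ℝ → (∀ x, 0 ≤ f x) → 0 ≤ m f
  const : ∀ c : ℝ, m (fun _ => c) = c
  translate : ∀ (g : Γ) (f), f ∈ boundedFun Γ ℝ → m (fun x => f (g * x)) = m f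

section SimpleIntegral

open MeasureTheory

variable {Γ : Type*}

/-- The integral of a finitely-valued function against a finitely additive set function. -/
noncomputable def simpleIntegral [MeasurableSpace Γ] (μ : Set Γ → ℝ) (s : SimpleFunc Γ ℝ) : ℝ :=
  s.setToSimpleFunc (fun S => μ S • ContinuousLinearMap.id ℝ ℝ)

theorem simpleIntegral_finMeasAdditive [MeasurableSpace Γ] {μ : Set Γ → ℝ}
    (hadd : ∀ S T : Set Γ, Disjoint S T → μ (S ∪ T) = μ S + μ T) :
    FinMeasAdditive (0 : Measure Γ) (fun S => μ S • ContinuousLinearMap.id ℝ ℝ) := by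
  intro S T _ _ _ _ h
  simp only [hadd S T h, add_smul]

theorem simpleIntegral_add [MeasurableSpace Γ] {μ : Set Γ → ℝ}
    (hadd : ∀ S T : Set Γ, Disjoint S T → μ (S ∪ T) = μ S + μ T) (s t : SimpleFunc Γ ℝ) :
    simpleIntegral μ (s + t) = simpleIntegral μ s + simpleIntegral μ t :=
  SimpleFunc.setToSimpleFunc_add _ (simpleIntegral_finMeasAdditive hadd)
    integrable_zero_measure integrable_zero_measure

theorem simpleIntegral_smul [MeasurableSpace Γ] {μ : Set Γ → ℝ}
    (hadd : ∀ S T : Set Γ, Disjoint S T → μ (S ∪ T) = μ S + μ T) (c : ℝ) (s : SimpleFunc Γ ℝ) :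
    simpleIntegral μ (c • s) = c * simpleIntegral μ s :=
  SimpleFunc.setToSimpleFunc_smul_real _ (simpleIntegral_finMeasAdditive hadd) c
    integrable_zero_measure

theorem simpleIntegral_mono [MeasurableSpace Γ] {μ : Set Γ → ℝ} (hpos : ∀ S : Set Γ, 0 ≤ μ S)
    (hadd : ∀ S T : Set Γ, Disjoint S T → μ (S ∪ T) = μ S + μ T) {s t : SimpleFunc Γ ℝ}
    (h : ∀ x, s x ≤ t x) : simpleIntegral μ s ≤ simpleIntegral μ t := by
  have h0 : 0 ≤ simpleIntegral μ (t + (-1 : ℝ) • s) := by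
    refine SimpleFunc.setToSimpleFunc_nonneg _ (fun S x hx => ?_) _ (fun x => ?_)
    · simpa using mul_nonneg (hpos S) hx
    · have := h x
      simp only [SimpleFunc.coe_zero, Pi.zero_apply, SimpleFunc.coe_add, SimpleFunc.coe_smul,
        Pi.add_apply, Pi.smul_apply, smul_eq_mul]
      linarith
  rw [simpleIntegral_add hadd, simpleIntegral_smul hadd] at h0
  linarith

theorem simpleIntegral_const [MeasurableSpace Γ] [Nonempty Γ] {μ : Set Γ → ℝ}
    (huniv : μ Set.univ = 1) (c : ℝ) : simpleIntegral μ (SimpleFunc.const Γ c) = c := by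
  simp [simpleIntegral, SimpleFunc.setToSimpleFunc_const', huniv]

theorem simpleIntegral_comp_mul_left [Group Γ] [MeasurableSpace Γ] {μ : Set Γ → ℝ}
    (hinv : ∀ (g : Γ) (S : Set Γ), μ ((fun x => g * x) '' S) = μ S)
    (g : Γ) (hg : Measurable fun x => g * x) (s : SimpleFunc Γ ℝ) :
    simpleIntegral μ (s.comp (fun x => g * x) hg) = simpleIntegral μ s := by
  have hrange : (s.comp (fun x => g * x) hg).range = s.range := by
    ext y
    simp only [SimpleFunc.mem_range, SimpleFunc.coe_comp, Set.mem_range, Function.comp]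
    constructor
    · rintro ⟨x, hx⟩
      exact ⟨_, hx⟩
    · rintro ⟨x, hx⟩
      exact ⟨g⁻¹ * x, by simpa using hx⟩
  simp only [simpleIntegral, SimpleFunc.setToSimpleFunc, hrange]
  refine Finset.sum_congr rfl fun y _ => ?_
  have hS : (s.comp (fun x => g * x) hg) ⁻¹' {y} = (fun x => g⁻¹ * x) '' (s ⁻¹' {y}) := by
    ext x
    simp only [SimpleFunc.coe_comp, Set.mem_preimage, Function.comp, Set.mem_image]
    constructor
    · intro hx
      exact ⟨g * x, hx, by simp⟩
    · rintro ⟨z, hz, rfl⟩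
      simpa using hz
  rw [hS, hinv]

theorem exists_simpleFunc_near [MeasurableSpace Γ] [DiscreteMeasurableSpace Γ] {f : Γ → ℝ}
    (hf : f ∈ boundedFun Γ ℝ) {c : ℝ} (hc : 0 < c) :
    ∃ s : SimpleFunc Γ ℝ, ∀ x, |f x - s x| ≤ c := by
  obtain ⟨C, hC⟩ := hf
  have hfin : (Set.range fun x => (⌊f x / c⌋ : ℝ) * c).Finite := by
    refine ((Set.finite_Icc ⌊-C / c⌋ ⌊C / c⌋).image fun k : ℤ => (k : ℝ) * c).subset ?_
    rintro _ ⟨x, rfl⟩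
    have hx := abs_le.1 (hC x)
    refine ⟨_, ⟨Int.floor_le_floor ?_, Int.floor_le_floor ?_⟩, rfl⟩
    · exact div_le_div_of_nonneg_right hx.1 hc.le
    · exact div_le_div_of_nonneg_right hx.2 hc.le
  refine ⟨⟨fun x => (⌊f x / c⌋ : ℝ) * c, fun _ => MeasurableSet.of_discrete, hfin⟩, fun x => ?_⟩
  change |f x - (⌊f x / c⌋ : ℝ) * c| ≤ c
  have h1 := Int.floor_le (f x / c)
  have h2 := Int.lt_floor_add_one (f x / c)
  rw [le_div_iff₀ hc] at h1
  rw [div_lt_iff₀ hc] at h2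
  rw [abs_le]
  constructor <;> nlinarith

/-- The upper integral of a function against a finitely additive set function. -/
noncomputable def upperIntegral [MeasurableSpace Γ] (μ : Set Γ → ℝ) (f : Γ → ℝ) : ℝ :=
  sInf {r | ∃ s : SimpleFunc Γ ℝ, (∀ x, f x ≤ s x) ∧ simpleIntegral μ s = r}

theorem abs_upperIntegral_sub_le [MeasurableSpace Γ] [Nonempty Γ] {μ : Set Γ → ℝ}
    (hpos : ∀ S : Set Γ, 0 ≤ μ S) (huniv : μ Set.univ = 1)
    (hadd : ∀ S T : Set Γ, Disjoint S T → μ (S ∪ T) = μ S + μ T) {f : Γ → ℝ}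
    {s : SimpleFunc Γ ℝ} {c : ℝ} (h : ∀ x, |f x - s x| ≤ c) :
    |upperIntegral μ f - simpleIntegral μ s| ≤ c := by
  have hconst (d : ℝ) : simpleIntegral μ (s + SimpleFunc.const Γ d) = simpleIntegral μ s + d := by
    rw [simpleIntegral_add hadd, simpleIntegral_const huniv]
  have hmem : simpleIntegral μ s + c ∈
      {r | ∃ s : SimpleFunc Γ ℝ, (∀ x, f x ≤ s x) ∧ simpleIntegral μ s = r} := by
    refine ⟨s + SimpleFunc.const Γ c, fun x => ?_, hconst c⟩
    have := (abs_le.1 (h x)).2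
    simp only [SimpleFunc.coe_add, SimpleFunc.coe_const, Pi.add_apply, Function.const_apply]
    linarith
  have hlow : ∀ r ∈ {r | ∃ s : SimpleFunc Γ ℝ, (∀ x, f x ≤ s x) ∧ simpleIntegral μ s = r},
      simpleIntegral μ s - c ≤ r := by
    rintro _ ⟨t, ht, rfl⟩
    rw [sub_eq_add_neg, ← hconst]
    refine simpleIntegral_mono hpos hadd fun x => ?_
    have h1 := (abs_le.1 (h x)).1
    have h2 := ht x
    simp only [SimpleFunc.coe_add, SimpleFunc.coe_const, Pi.add_apply, Function.const_apply]
    linarith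
  rw [abs_le]
  constructor
  · linarith [le_csInf ⟨_, hmem⟩ hlow, show upperIntegral μ f = sInf _ from rfl]
  · linarith [csInf_le ⟨_, hlow⟩ hmem, show upperIntegral μ f = sInf _ from rfl]

end SimpleIntegral

theorem eq_of_forall_abs_sub_le_mul {a b K : ℝ} (h : ∀ c : ℝ, 0 < c → |a - b| ≤ K * c) :
    a = b := by
  by_contra hne
  have h0 : 0 < |a - b| := abs_pos.2 (sub_ne_zero.2 hne)
  have hK : 0 < |K| + 1 := by positivity
  have h1 := h (|a - b| / (2 * (|K| + 1))) (by positivity)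
  have h2 : K * (|a - b| / (2 * (|K| + 1))) ≤ (|K| + 1) * (|a - b| / (2 * (|K| + 1))) :=
    mul_le_mul_of_nonneg_right (by linarith [le_abs_self K]) (by positivity)
  have h3 : (|K| + 1) * (|a - b| / (2 * (|K| + 1))) = |a - b| / 2 := by field_simp
  linarith

theorem IsAmenable.exists_isInvariantMean {Γ : Type*} [Group Γ] (h : IsAmenable Γ) :
    ∃ m : (Γ → ℝ) → ℝ, IsInvariantMean m := by
  obtain ⟨μ, hpos, huniv, hadd, hinv⟩ := h
  let _ : MeasurableSpace Γ := ⊤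
  have key {f : Γ → ℝ} {s : MeasureTheory.SimpleFunc Γ ℝ} {c : ℝ} (h : ∀ x, |f x - s x| ≤ c) :=
    abs_upperIntegral_sub_le hpos huniv hadd h
  refine ⟨upperIntegral μ, ⟨fun f g hf hg => ?_, fun c f hf => ?_, fun f hf h0 => ?_,
    fun c => ?_, fun g f hf => ?_⟩⟩
  · refine eq_of_forall_abs_sub_le_mul (K := 4) fun c hc => ?_
    obtain ⟨s, hs⟩ := exists_simpleFunc_near hf hc
    obtain ⟨t, ht⟩ := exists_simpleFunc_near hg hc
    have hst : ∀ x, |(f + g) x - (s + t) x| ≤ 2 * c := fun x => by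
      have h1 := abs_le.1 (hs x)
      have h2 := abs_le.1 (ht x)
      simp only [Pi.add_apply, MeasureTheory.SimpleFunc.coe_add]
      rw [abs_le]
      constructor <;> linarith
    have h1 := abs_le.1 (key hs)
    have h2 := abs_le.1 (key ht)
    have h3 := abs_le.1 (key hst)
    rw [simpleIntegral_add hadd] at h3
    rw [abs_le]
    constructor <;> linarith
  · refine eq_of_forall_abs_sub_le_mul (K := 2 * |c|) fun d hd => ?_
    obtain ⟨s, hs⟩ := exists_simpleFunc_near hf hd
    have hcs : ∀ x, |(c • f) x - (c • s) x| ≤ |c| * d := fun x => by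
      simp only [Pi.smul_apply, MeasureTheory.SimpleFunc.coe_smul, smul_eq_mul]
      rw [← mul_sub, abs_mul]
      exact mul_le_mul_of_nonneg_left (hs x) (abs_nonneg c)
    have h1 := mul_le_mul_of_nonneg_left (key hs) (abs_nonneg c)
    have h2 := key hcs
    rw [simpleIntegral_smul hadd] at h2
    rw [← abs_mul, mul_sub, abs_sub_comm] at h1
    refine (abs_sub_le _ (c * simpleIntegral μ s) _).trans ?_
    linarith
  · refine le_of_forall_pos_le_add fun c hc => ?_
    obtain ⟨s, hs⟩ := exists_simpleFunc_near hf (half_pos hc)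
    have h1 := abs_le.1 (key hs)
    have h2 : simpleIntegral μ (MeasureTheory.SimpleFunc.const Γ (-(c / 2))) ≤
        simpleIntegral μ s :=
      simpleIntegral_mono hpos hadd fun x => by
        have h3 := abs_le.1 (hs x)
        have h4 := h0 x
        simp only [MeasureTheory.SimpleFunc.coe_const, Function.const_apply]
        linarith
    rw [simpleIntegral_const huniv] at h2
    linarith
  · refine eq_of_forall_abs_sub_le_mul (K := 1) fun d hd => ?_
    have := key (f := fun _ => c) (s := MeasureTheory.SimpleFunc.const Γ c) (c := 0) (by simp)
    rw [simpleIntegral_const huniv] at this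
    linarith
  · refine eq_of_forall_abs_sub_le_mul (K := 2) fun c hc => ?_
    obtain ⟨s, hs⟩ := exists_simpleFunc_near hf hc
    have h1 := key hs
    have h2 := key (f := fun x => f (g * x))
      (s := s.comp (fun x => g * x) (measurable_from_top)) fun x => hs (g * x)
    rw [simpleIntegral_comp_mul_left hinv] at h2
    rw [abs_sub_comm] at h1
    linarith [abs_sub_le (upperIntegral μ fun x => f (g * x)) (simpleIntegral μ s)
      (upperIntegral μ f)]
section MeanOperator

open scoped RealInnerProductSpace

variable {Γ : Type*}

theorem inner_mem_boundedFun {K : Type*} [NormedAddCommGroup K] [InnerProductSpace ℝ K]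
    {f h : Γ → K} (hf : f ∈ boundedFun Γ K) (hh : h ∈ boundedFun Γ K) :
    (fun x => ⟪f x, h x⟫) ∈ boundedFun Γ ℝ := by
  obtain ⟨C, hC⟩ := hf
  obtain ⟨D, hD⟩ := hh
  refine ⟨C * D, fun x => (norm_inner_le_norm _ _).trans ?_⟩
  exact mul_le_mul (hC x) (hD x) (norm_nonneg _) ((norm_nonneg _).trans (hC x))

theorem const_mem_boundedFun {K : Type*} [NormedAddCommGroup K] [NormedSpace ℝ K] (a : K) :
    (fun _ => a) ∈ boundedFun Γ K :=
  ⟨‖a‖, fun _ => le_rfl⟩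

theorem clm_apply_mem_boundedFun {H : Type*} [NormedAddCommGroup H] [InnerProductSpace ℝ H]
    {A : Γ → H →L[ℝ] H} (hA : ∀ x, ‖A x‖ ≤ 1) (ξ : H) : (fun x => A x ξ) ∈ boundedFun Γ H :=
  ⟨‖ξ‖, fun x => by simpa using (A x).le_of_opNorm_le (hA x) ξ⟩

namespace IsInvariantMean

variable [Group Γ] {m : (Γ → ℝ) → ℝ}

theorem sub (hm : IsInvariantMean m) {f g : Γ → ℝ} (hf : f ∈ boundedFun Γ ℝ)
    (hg : g ∈ boundedFun Γ ℝ) : m (fun x => f x - g x) = m f - m g := by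
  have h := hm.add f ((-1 : ℝ) • g) hf (Submodule.smul_mem _ _ hg)
  rw [hm.smul _ g hg] at h
  have e : (fun x => f x - g x) = f + (-1 : ℝ) • g := by
    ext x
    simp [sub_eq_add_neg]
  rw [e, h]
  ring

theorem mono (hm : IsInvariantMean m) {f g : Γ → ℝ} (hf : f ∈ boundedFun Γ ℝ)
    (hg : g ∈ boundedFun Γ ℝ) (h : ∀ x, f x ≤ g x) : m f ≤ m g := by
  have h1 := hm.nonneg _ (Submodule.sub_mem _ hg hf) fun x => sub_nonneg.2 (h x)
  have h2 := hm.sub hg hf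
  have e : g - f = fun x => g x - f x := rfl
  rw [e] at h1
  linarith

theorem le_const (hm : IsInvariantMean m) {f : Γ → ℝ} (hf : f ∈ boundedFun Γ ℝ) {C : ℝ}
    (h : ∀ x, f x ≤ C) : m f ≤ C := by
  have := hm.mono hf (const_mem_boundedFun C) h
  rwa [hm.const] at this

theorem abs_le_const (hm : IsInvariantMean m) {f : Γ → ℝ} {C : ℝ}
    (h : ∀ x, |f x| ≤ C) : |m f| ≤ C := by
  have hf : f ∈ boundedFun Γ ℝ := ⟨C, h⟩
  have h1 := hm.mono (const_mem_boundedFun (-C)) hf fun x => (abs_le.1 (h x)).1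
  rw [hm.const] at h1
  exact abs_le.2 ⟨h1, hm.le_const hf fun x => (abs_le.1 (h x)).2⟩

theorem sum (hm : IsInvariantMean m) {ι : Type*} (s : Finset ι) (f : ι → Γ → ℝ)
    (hf : ∀ i, f i ∈ boundedFun Γ ℝ) : m (fun x => ∑ i ∈ s, f i x) = ∑ i ∈ s, m (f i) := by
  classical
  induction s using Finset.induction_on with
  | empty => simpa using hm.const 0
  | insert a s ha ih =>
    rw [Finset.sum_insert ha, ← ih, ← hm.add _ _ (hf a)]
    · congr 1
      ext x
      simp [Finset.sum_insert ha]
    · have := Submodule.sum_mem (boundedFun Γ ℝ) (t := s) fun i _ => hf i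
      convert this using 1
      ext x
      simp

theorem exists_mean_clm {H : Type*} [NormedAddCommGroup H] [InnerProductSpace ℝ H]
    [CompleteSpace H] (hm : IsInvariantMean m) {A : Γ → H →L[ℝ] H}
    (hA : ∀ x, ‖A x‖ ≤ 1) :
    ∃ T : H →L[ℝ] H, ∀ ξ η, ⟪T ξ, η⟫ = m (fun x => ⟪A x ξ, η⟫) := by
  have hb (ξ η : H) : (fun x => ⟪A x ξ, η⟫) ∈ boundedFun Γ ℝ :=
    inner_mem_boundedFun (clm_apply_mem_boundedFun hA ξ) (const_mem_boundedFun η)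
  let B : H →ₗ⋆[ℝ] H →ₗ[ℝ] ℝ :=
    LinearMap.mk₂'ₛₗ (starRingEnd ℝ) (RingHom.id ℝ) (fun ξ η => m (fun x => ⟪A x ξ, η⟫))
      (fun ξ ξ' η => by
        rw [← hm.add _ _ (hb ξ η) (hb ξ' η)]
        congr 1
        ext x
        simp [inner_add_left])
      (fun c ξ η => by
        have := hm.smul c _ (hb ξ η)
        simp only [conj_trivial, smul_eq_mul]
        rw [← this]
        congr 1
        ext x
        simp [inner_smul_left])
      (fun ξ η η' => by
        rw [← hm.add _ _ (hb ξ η) (hb ξ η')]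
        congr 1
        ext x
        simp [inner_add_right])
      (fun c ξ η => by
        have := hm.smul c _ (hb ξ η)
        simp only [RingHom.id_apply, smul_eq_mul]
        rw [← this]
        congr 1
        ext x
        simp [inner_smul_right])
  let B' : H →L⋆[ℝ] H →L[ℝ] ℝ := B.mkContinuous₂ 1 fun ξ η => by
    refine hm.abs_le_const fun x => ?_
    rw [one_mul]
    refine (abs_real_inner_le_norm _ _).trans ?_
    refine mul_le_mul_of_nonneg_right ?_ (norm_nonneg _)
    simpa using (A x).le_of_opNorm_le (hA x) ξ
  exact ⟨InnerProductSpace.continuousLinearMapOfBilin B', fun ξ η => by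
    rw [InnerProductSpace.continuousLinearMapOfBilin_apply]
    rfl⟩

end IsInvariantMean

end MeanOperator

section CompactOperator

open scoped RealInnerProductSpace

variable {H : Type*} [NormedAddCommGroup H] [InnerProductSpace ℝ H]

theorem ContinuousLinearMap.IsPositive.inner_sq_le {T : H →L[ℝ] H} (hT : T.IsPositive) (x y : H) :
    ⟪T x, y⟫ ^ 2 ≤ ⟪T x, x⟫ * ⟪T y, y⟫ := by
  have h (t : ℝ) : 0 ≤ ⟪T y, y⟫ * (t * t) + (2 * ⟪T x, y⟫) * t + ⟪T x, x⟫ := by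
    have h1 : 0 ≤ ⟪T (x + t • y), x + t • y⟫ := hT.re_inner_nonneg_left (x + t • y)
    have h2 : ⟪T y, x⟫ = ⟪T x, y⟫ := by
      rw [hT.inner_left_eq_inner_right, real_inner_comm]
    simp only [map_add, map_smul, inner_add_left, inner_add_right, inner_smul_left,
      inner_smul_right, conj_trivial, h2] at h1
    linarith
  have := discrim_le_zero h
  unfold discrim at this
  nlinarith

theorem ContinuousLinearMap.IsPositive.norm_sq_le {T : H →L[ℝ] H} (hT : T.IsPositive) (x : H) :
    ‖T x‖ ^ 2 ≤ ‖T‖ * ⟪T x, x⟫ := by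
  have h1 := hT.inner_sq_le x (T x)
  rw [real_inner_self_eq_norm_sq] at h1
  have h2 : ⟪T (T x), T x⟫ ≤ ‖T‖ * ‖T x‖ ^ 2 := by
    refine (real_inner_le_norm _ _).trans ?_
    rw [sq, ← mul_assoc]
    exact mul_le_mul_of_nonneg_right (T.le_opNorm _) (norm_nonneg _)
  have h3 : 0 ≤ ⟪T x, x⟫ := hT.re_inner_nonneg_left x
  rcases (sq_nonneg ‖T x‖).eq_or_lt with h0 | h0
  · rw [← h0]
    positivity
  · have h4 := h1.trans (mul_le_mul_of_nonneg_left h2 h3)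
    nlinarith

/-- A positive operator with finite trace is compact. -/
theorem ContinuousLinearMap.IsPositive.isCompactOperator [CompleteSpace H] {T : H →L[ℝ] H}
    (hT : T.IsPositive) {C : ℝ}
    (htr : ∀ (f : ℕ → H), Orthonormal ℝ f → ∀ N, ∑ i ∈ Finset.range N, ⟪T (f i), f i⟫ ≤ C) :
    IsCompactOperator T := by
  have hsmall (η : ℝ) (hη : 0 < η) :
      ∃ s : Finset H, ∀ f, ‖f‖ = 1 → (∀ x ∈ s, ⟪x, f⟫ = 0) → ⟪T f, f⟫ ≤ η := by
    by_contra! hcon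
    obtain ⟨f, hf1, hf2⟩ := exists_seq_of_forall_finset_exists
      (fun f : H => ‖f‖ = 1 ∧ η < ⟪T f, f⟫) (fun x y => ⟪x, y⟫ = 0) fun s _ => by
        obtain ⟨y, hy1, hy2, hy3⟩ := hcon s
        exact ⟨y, ⟨hy1, hy3⟩, hy2⟩
    have hon : Orthonormal ℝ f := by
      refine ⟨fun i => (hf1 i).1, fun i j hij => ?_⟩
      rcases lt_or_gt_of_ne hij with h | h
      · exact hf2 _ _ h
      · rw [real_inner_comm]
        exact hf2 _ _ h
    obtain ⟨N, hN⟩ := exists_nat_gt (C / η)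
    have h1 := htr f hon N
    have h2 : ∑ i ∈ Finset.range N, η ≤ ∑ i ∈ Finset.range N, ⟪T (f i), f i⟫ :=
      Finset.sum_le_sum fun i _ => (hf1 i).2.le
    rw [Finset.sum_const, Finset.card_range, nsmul_eq_mul] at h2
    rw [div_lt_iff₀ hη] at hN
    linarith
  have happrox (k : ℕ) : ∃ S : H →L[ℝ] H, IsCompactOperator S ∧
      ‖T - S‖ ≤ Real.sqrt (‖T‖ * (1 / ((k : ℝ) + 1))) := by
    obtain ⟨s, hs⟩ := hsmall (1 / ((k : ℝ) + 1)) (by positivity)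
    let F : Submodule ℝ H := Submodule.span ℝ (s : Set H)
    have : FiniteDimensional ℝ F := FiniteDimensional.span_finset ℝ s
    refine ⟨T ∘L F.starProjection, ?_, ?_⟩
    · have h1 : IsCompactOperator (T ∘L F.subtypeL) :=
        isCompactOperator_of_locallyCompactSpace_rng (T ∘L F.subtypeL)
      exact h1.comp_clm F.orthogonalProjectionOnto
    · refine ContinuousLinearMap.opNorm_le_bound _ (Real.sqrt_nonneg _) fun x => ?_
      set y := x - F.starProjection x with hy
      have hyF : y ∈ Fᗮ := F.sub_starProjection_mem_orthogonal x
      have hynorm : ‖y‖ ≤ ‖x‖ := by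
        have h1 := F.norm_sq_eq_add_norm_sq_starProjection x
        rw [Submodule.starProjection_orthogonal_val] at h1
        have : ‖y‖ ^ 2 ≤ ‖x‖ ^ 2 := by rw [hy]; nlinarith [sq_nonneg ‖F.starProjection x‖]
        exact le_of_sq_le_sq this (norm_nonneg x)
      have hTy : ⟪T y, y⟫ ≤ 1 / ((k : ℝ) + 1) * ‖y‖ ^ 2 := by
        rcases eq_or_ne y 0 with h0 | h0
        · simp [h0]
        · have hpos : 0 < ‖y‖ := norm_pos_iff.2 h0
          have := hs (‖y‖⁻¹ • y) (by rw [norm_smul, norm_inv, norm_norm, inv_mul_cancel₀ hpos.ne'])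
            fun z hz => by
              rw [inner_smul_right, (Submodule.mem_orthogonal F y).1 hyF z
                (Submodule.subset_span hz), mul_zero]
          rw [map_smul, inner_smul_left, inner_smul_right, conj_trivial, ← mul_assoc,
            ← mul_inv, ← sq, inv_mul_le_iff₀ (by positivity)] at this
          linarith
      have hval : (T - T ∘L F.starProjection) x = T y := by simp [hy]
      rw [hval]
      refine le_of_sq_le_sq ?_ (by positivity)
      rw [mul_pow, Real.sq_sqrt (by positivity)]
      calc ‖T y‖ ^ 2 ≤ ‖T‖ * ⟪T y, y⟫ := hT.norm_sq_le y
        _ ≤ ‖T‖ * (1 / ((k : ℝ) + 1) * ‖x‖ ^ 2) := by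
          refine mul_le_mul_of_nonneg_left (hTy.trans ?_) (norm_nonneg _)
          gcongr
        _ = _ := by ring
  choose S hS1 hS2 using happrox
  have hlim : Filter.Tendsto S Filter.atTop (nhds T) := by
    rw [tendsto_iff_norm_sub_tendsto_zero]
    have h0 : Filter.Tendsto (fun k : ℕ => Real.sqrt (‖T‖ * (1 / ((k : ℝ) + 1)))) Filter.atTop
        (nhds 0) := by
      have := (tendsto_one_div_add_atTop_nhds_zero_nat (𝕜 := ℝ)).const_mul ‖T‖
      simpa using this.sqrt
    refine squeeze_zero (fun _ => norm_nonneg _) (fun k => ?_) h0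
    rw [norm_sub_rev]
    exact hS2 k
  exact isCompactOperator_of_tendsto hlim (Filter.Eventually.of_forall hS1)

end CompactOperator
section Representation

open scoped RealInnerProductSpace

variable {Γ : Type*} [Group Γ] {H : Type*} [NormedAddCommGroup H] [InnerProductSpace ℝ H]

theorem map_mul_apply (π : Γ →* (H ≃ₗᵢ[ℝ] H)) (g h : Γ) (x : H) : π (g * h) x = π g (π h x) := by
  rw [map_mul]
  rfl

theorem map_map_inv_apply (π : Γ →* (H ≃ₗᵢ[ℝ] H)) (g : Γ) (x : H) : π g (π g⁻¹ x) = x := by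
  rw [← map_mul_apply, mul_inv_cancel, map_one]
  rfl

theorem inner_map_inv_right (π : Γ →* (H ≃ₗᵢ[ℝ] H)) (g : Γ) (x y : H) :
    ⟪π g x, y⟫ = ⟪x, π g⁻¹ y⟫ := by
  rw [← (π g).inner_map_map x (π g⁻¹ y), map_map_inv_apply]

/-- If all finite-dimensional unitary representations are trivial, then every vector of a
finite-dimensional invariant subspace of an orthogonal representation is fixed. -/
theorem map_eq_self_of_mem_finiteDimensional
    (htriv : ∀ (n : ℕ) (π : Γ →* Matrix.unitaryGroup (Fin n) ℂ) (g : Γ), π g = 1)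
    (π : Γ →* (H ≃ₗᵢ[ℝ] H)) (F : Submodule ℝ H) [FiniteDimensional ℝ F]
    (hF : ∀ g, ∀ w ∈ F, π g w ∈ F) (g : Γ) {w : H} (hw : w ∈ F) : π g w = w := by
  let b := stdOrthonormalBasis ℝ F
  let M : Γ → Matrix (Fin (Module.finrank ℝ F)) (Fin (Module.finrank ℝ F)) ℂ :=
    fun g => Matrix.of fun i j => ((⟪(b i : H), π g (b j)⟫ : ℝ) : ℂ)
  have hMone : M 1 = 1 := by
    ext i j
    have h : ⟪(b i : H), (b j : H)⟫ = if i = j then 1 else 0 :=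
      orthonormal_iff_ite.1 b.orthonormal i j
    simp only [M, Matrix.of_apply, map_one, LinearIsometryEquiv.coe_one, id_eq, h,
      Matrix.one_apply]
    split_ifs <;> simp
  have hMmul (g h : Γ) : M (g * h) = M g * M h := by
    ext i j
    simp only [M, Matrix.of_apply, Matrix.mul_apply]
    have h1 := b.sum_inner_mul_inner (⟨π g⁻¹ (b i), hF _ _ (b i).2⟩ : F)
      (⟨π h (b j), hF _ _ (b j).2⟩ : F)
    simp only [Submodule.coe_inner] at h1
    rw [map_mul_apply, real_inner_comm, inner_map_inv_right, real_inner_comm, ← h1]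
    push_cast
    refine Finset.sum_congr rfl fun k _ => ?_
    rw [real_inner_comm, ← inner_map_inv_right, real_inner_comm]
  have hMstar (g : Γ) : star (M g) = M g⁻¹ := by
    ext i j
    simp only [M, Matrix.star_apply, Matrix.of_apply]
    rw [← inner_map_inv_right, real_inner_comm]
    simp
  let ρ : Γ →* Matrix.unitaryGroup (Fin (Module.finrank ℝ F)) ℂ :=
    { toFun := fun g => ⟨M g, by
        rw [Matrix.mem_unitaryGroup_iff, hMstar, ← hMmul, mul_inv_cancel, hMone]⟩
      map_one' := Subtype.ext hMone
      map_mul' := fun g h => Subtype.ext (hMmul g h) }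
  have hM1 : M g = M 1 := by
    have := congrArg Subtype.val (htriv _ ρ g)
    rw [hMone]
    exact this
  have hcoord (j) : π g (b j) = b j := by
    have h1 : (⟨π g (b j), hF _ _ (b j).2⟩ : F) = b j := by
      apply b.repr.injective
      ext i
      rw [b.repr_apply_apply, b.repr_apply_apply]
      have h2 := congrFun (congrFun hM1 i) j
      simp only [M, Matrix.of_apply, map_one, LinearIsometryEquiv.coe_one, id_eq,
        Complex.ofReal_inj] at h2
      exact h2
    exact congrArg Subtype.val h1
  have hrepr := b.sum_repr ⟨w, hw⟩
  have hw' : w = ∑ i, b.repr ⟨w, hw⟩ i • (b i : H) := by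
    conv_lhs => rw [show w = ((⟨w, hw⟩ : F) : H) from rfl, ← hrepr]
    simp
  rw [hw', map_sum]
  exact Finset.sum_congr rfl fun i _ => by rw [map_smul, hcoord]

/-- If all finite-dimensional unitary representations are trivial, then the range of every
intertwining compact symmetric operator consists of fixed vectors. -/
theorem map_apply_eq_of_isCompactOperator [CompleteSpace H]
    (htriv : ∀ (n : ℕ) (π : Γ →* Matrix.unitaryGroup (Fin n) ℂ) (g : Γ), π g = 1)
    (π : Γ →* (H ≃ₗᵢ[ℝ] H)) {T : H →L[ℝ] H} (hT : IsCompactOperator T) (hsymm : T.IsSymmetric)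
    (hcomm : ∀ g x, T (π g x) = π g (T x)) (g : Γ) (z : H) : π g (T z) = T z := by
  have hfix (μ : ℝ) {w : H} (hw : T w = μ • w) (g : Γ) : T (π g w - w) = 0 := by
    by_cases hμ : μ = 0
    · rw [map_sub, hcomm, hw, hμ]
      simp
    · have := ContinuousLinearMap.finite_dimensional_eigenspace hT μ hμ
      rw [map_eq_self_of_mem_finiteDimensional htriv π
        (Module.End.eigenspace T.toLinearMap μ) (fun g w hw => ?_) g
        (Module.End.mem_eigenspace_iff.2 hw), sub_self, map_zero]
      rw [Module.End.mem_eigenspace_iff] at hw ⊢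
      change T w = μ • w at hw
      change T (π g w) = μ • π g w
      rw [hcomm, hw, map_smul]
  have hmem : π g (T z) - T z ∈
      (⨆ μ, Module.End.eigenspace (T : Module.End ℝ H) μ)ᗮ := by
    rw [← Submodule.iInf_orthogonal, Submodule.mem_iInf]
    intro μ
    rw [Submodule.mem_orthogonal]
    intro w hw
    have hw' : T w = μ • w := Module.End.mem_eigenspace_iff.1 hw
    have h1 : ⟪w, T z⟫ = ⟪T w, z⟫ := (hsymm w z).symm
    have h2 : ⟪π g⁻¹ w, T z⟫ = ⟪T (π g⁻¹ w), z⟫ := (hsymm _ z).symm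
    have h3 : T (π g⁻¹ w) = T w := sub_eq_zero.1 (by rw [← map_sub, hfix μ hw'])
    rw [inner_sub_right, real_inner_comm, inner_map_inv_right, real_inner_comm, h2, h3, h1,
      sub_self]
  rw [ContinuousLinearMap.orthogonalComplement_iSup_eigenspaces_eq_bot hT hsymm,
    Submodule.mem_bot] at hmem
  exact sub_eq_zero.1 hmem

/-- A vector that is close to all translates of a finite-dimensional subspace is almost fixed, if
the group is amenable and has no nontrivial finite-dimensional unitary representations. -/
theorem norm_map_sub_le_of_near_translates [CompleteSpace H]
    (htriv : ∀ (n : ℕ) (π : Γ →* Matrix.unitaryGroup (Fin n) ℂ) (g : Γ), π g = 1)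
    {m : (Γ → ℝ) → ℝ} (hm : IsInvariantMean m) (π : Γ →* (H ≃ₗᵢ[ℝ] H))
    (E : Submodule ℝ H) [FiniteDimensional ℝ E] {v : H} {ε : ℝ}
    (hv : ∀ x, ∃ e ∈ E, ‖v - π x e‖ ≤ ε) (g : Γ) : ‖π g v - v‖ ≤ 2 * ε := by
  let A : Γ → H →L[ℝ] H := fun x =>
    ((π x : H ≃L[ℝ] H) : H →L[ℝ] H) ∘L E.starProjection ∘L ((π x⁻¹ : H ≃L[ℝ] H) : H →L[ℝ] H)
  have hAdef (x : Γ) (ξ : H) : A x ξ = π x (E.starProjection (π x⁻¹ ξ)) := rfl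
  have hA (x : Γ) : ‖A x‖ ≤ 1 := by
    refine ContinuousLinearMap.opNorm_le_bound _ zero_le_one fun ξ => ?_
    rw [hAdef, LinearIsometryEquiv.norm_map]
    refine (E.starProjection.le_of_opNorm_le E.starProjection_norm_le _).trans ?_
    rw [LinearIsometryEquiv.norm_map]
  have hAsymm (x : Γ) (ξ η : H) : ⟪A x ξ, η⟫ = ⟪A x η, ξ⟫ := by
    rw [hAdef, hAdef, inner_map_inv_right, inner_map_inv_right,
      Submodule.inner_starProjection_left_eq_right, real_inner_comm]
  have hAself (x : Γ) (ξ : H) : ⟪A x ξ, ξ⟫ = ‖E.starProjection (π x⁻¹ ξ)‖ ^ 2 := by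
    rw [hAdef, inner_map_inv_right]
    have := Submodule.inner_starProjection_left_eq_right E (E.starProjection (π x⁻¹ ξ)) (π x⁻¹ ξ)
    rw [← real_inner_self_eq_norm_sq, ← this]
    congr 1
    exact (Submodule.starProjection_eq_self_iff.2 (E.starProjection_apply_mem _)).symm
  have hAb (ξ η : H) : (fun x => ⟪A x ξ, η⟫) ∈ boundedFun Γ ℝ :=
    inner_mem_boundedFun (clm_apply_mem_boundedFun hA ξ) (const_mem_boundedFun η)
  obtain ⟨T, hT⟩ := hm.exists_mean_clm hA
  have hTsymm : T.IsSymmetric := fun ξ η => by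
    change ⟪T ξ, η⟫ = ⟪ξ, T η⟫
    rw [real_inner_comm (T η), hT, hT]
    simp only [hAsymm]
  have hTpos : T.IsPositive := by
    rw [ContinuousLinearMap.isPositive_def]
    refine ⟨hTsymm, fun ξ => ?_⟩
    change 0 ≤ ⟪T ξ, ξ⟫
    rw [hT]
    refine hm.nonneg _ (hAb ξ ξ) fun x => ?_
    rw [hAself]
    positivity
  have hTcomm (g : Γ) (ξ : H) : T (π g ξ) = π g (T ξ) := by
    refine ext_inner_right ℝ fun η => ?_
    rw [hT, inner_map_inv_right, hT, ← hm.translate g _ (hAb _ _)]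
    congr 1
    ext x
    rw [← inner_map_inv_right, hAdef, hAdef, mul_inv_rev, map_mul_apply, map_mul_apply]
    have h1 (y : H) : π g⁻¹ (π g y) = y := by simp
    rw [h1]
  have hTcompact : IsCompactOperator T := by
    refine hTpos.isCompactOperator (C := Module.finrank ℝ E) fun f hf N => ?_
    simp only [hT]
    rw [← hm.sum _ (fun i x => ⟪A x (f i), f i⟫) fun i => hAb _ _]
    refine hm.le_const ?_ fun x => ?_
    · have := Submodule.sum_mem (boundedFun Γ ℝ) (t := Finset.range N) fun i _ => hAb (f i) (f i)
      convert this using 1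
      ext x
      simp
    · let b := stdOrthonormalBasis ℝ E
      have hnorm (y : H) : ‖E.starProjection y‖ ^ 2 = ∑ j, ⟪y, b j⟫ ^ 2 := by
        have h1 := b.sum_sq_norm_inner_left (E.orthogonalProjectionOnto y)
        have h2 : ‖E.starProjection y‖ = ‖E.orthogonalProjectionOnto y‖ := rfl
        rw [h2, ← h1]
        refine Finset.sum_congr rfl fun j _ => ?_
        rw [Real.norm_eq_abs, sq_abs]
        rw [real_inner_comm, Submodule.inner_orthogonalProjectionOnto_eq_of_mem_left,
          real_inner_comm]
      have hon : Orthonormal ℝ fun i => π x⁻¹ (f i) :=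
        hf.comp_linearIsometryEquiv (π x⁻¹)
      calc ∑ i ∈ Finset.range N, ⟪A x (f i), f i⟫
          = ∑ i ∈ Finset.range N, ∑ j, ⟪π x⁻¹ (f i), b j⟫ ^ 2 :=
            Finset.sum_congr rfl fun i _ => by rw [hAself, hnorm]
        _ = ∑ j, ∑ i ∈ Finset.range N, ⟪π x⁻¹ (f i), b j⟫ ^ 2 := Finset.sum_comm
        _ ≤ ∑ j : Fin (Module.finrank ℝ E), (1 : ℝ) := by
          refine Finset.sum_le_sum fun j _ => ?_
          have h1 := hon.sum_inner_products_le (b j : H) (s := Finset.range N)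
          have h2 : ‖(b j : H)‖ = 1 := b.orthonormal.1 j
          rw [h2] at h1
          simpa using h1
        _ = Module.finrank ℝ E := by simp
  have hAv (x : Γ) : ‖v - A x v‖ ≤ ε := by
    obtain ⟨e, he, hve⟩ := hv x
    have h1 : v - A x v = π x (Eᗮ.starProjection (π x⁻¹ (v - π x e))) := by
      rw [Submodule.starProjection_orthogonal_val, map_sub (π x⁻¹)]
      have h2 : π x⁻¹ (π x e) = e := by simp
      rw [h2, map_sub E.starProjection, Submodule.starProjection_eq_self_iff.2 he]
      simp only [map_sub, hAdef, map_map_inv_apply]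
      abel
    rw [h1, LinearIsometryEquiv.norm_map]
    refine (Eᗮ.starProjection.le_of_opNorm_le Eᗮ.starProjection_norm_le _).trans ?_
    rwa [LinearIsometryEquiv.norm_map, one_mul]
  have hTv : ‖v - T v‖ ≤ ε := by
    have h1 : ⟪v - T v, v - T v⟫ = m (fun x => ⟪v - A x v, v - T v⟫) := by
      have h2 := hm.sub (const_mem_boundedFun (⟪v, v - T v⟫ : ℝ)) (hAb v (v - T v))
      rw [hm.const, ← hT, ← inner_sub_left] at h2
      rw [← h2]
      simp only [inner_sub_left]
    have h3 : m (fun x => ⟪v - A x v, v - T v⟫) ≤ ε * ‖v - T v‖ := by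
      refine (le_abs_self _).trans (hm.abs_le_const fun x => ?_)
      exact (abs_real_inner_le_norm _ _).trans
        (mul_le_mul_of_nonneg_right (hAv x) (norm_nonneg _))
    rw [← h1, real_inner_self_eq_norm_sq, sq] at h3
    rcases (norm_nonneg (v - T v)).eq_or_lt with h0 | h0
    · rw [← h0]
      exact (norm_nonneg _).trans (hAv 1)
    · exact le_of_mul_le_mul_right h3 h0
  have hfix := map_apply_eq_of_isCompactOperator htriv π hTcompact hTsymm hTcomm g v
  have hsplit : π g v - v = π g (v - T v) - (v - T v) := by
    rw [map_sub, hfix]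
    abel
  rw [hsplit]
  refine (norm_sub_le _ _).trans ?_
  rw [LinearIsometryEquiv.norm_map]
  linarith

end Representation

section GNS

open scoped RealInnerProductSpace

/-- An isometric linear action on a seminormed space extends to its completion. -/
theorem exists_completion_action {Γ : Type*} [Group Γ] {E : Type*} [SeminormedAddCommGroup E]
    [NormedSpace ℝ E] (L : Γ → E →ₗ[ℝ] E) (hone : ∀ x, L 1 x = x)
    (hmul : ∀ g h x, L (g * h) x = L g (L h x)) (hnorm : ∀ g x, ‖L g x‖ = ‖x‖) :
    ∃ π : Γ →* (UniformSpace.Completion E ≃ₗᵢ[ℝ] UniformSpace.Completion E),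
      ∀ g (x : E), π g x = (L g x : E) := by
  let T : Γ → UniformSpace.Completion E →L[ℝ] UniformSpace.Completion E := fun g =>
    ((L g).mkContinuous 1 fun x => by rw [hnorm, one_mul]).completion
  have hT (g : Γ) (x : E) : T g x = (L g x : E) := ContinuousLinearMap.completion_apply_coe _ _
  have hTone (y) : T 1 y = y := by
    induction y using UniformSpace.Completion.induction_on with
    | hp => exact isClosed_eq (T 1).continuous continuous_id
    | ih x => rw [hT, hone]
  have hTmul (g h : Γ) (y) : T (g * h) y = T g (T h y) := by
    induction y using UniformSpace.Completion.induction_on with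
    | hp => exact isClosed_eq (T _).continuous ((T g).continuous.comp (T h).continuous)
    | ih x => rw [hT, hT, hT, hmul]
  have hTnorm (g : Γ) (y) : ‖T g y‖ = ‖y‖ := by
    induction y using UniformSpace.Completion.induction_on with
    | hp => exact isClosed_eq (T g).continuous.norm continuous_norm
    | ih x => rw [hT, UniformSpace.Completion.norm_coe, UniformSpace.Completion.norm_coe, hnorm]
  refine ⟨
    { toFun := fun g =>
        { toLinearEquiv := LinearEquiv.ofLinearMap (T g).toLinearMap (T g⁻¹).toLinearMap
            (LinearMap.ext fun y => by simp [← hTmul, hTone])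
            (LinearMap.ext fun y => by simp [← hTmul, hTone])
          norm_map' := hTnorm g }
      map_one' := LinearIsometryEquiv.ext hTone
      map_mul' := fun g h => LinearIsometryEquiv.ext (hTmul g h) }, hT⟩

variable {Γ : Type*} [Group Γ] {m : (Γ → ℝ) → ℝ}

/-- Left translation of bounded functions. -/
def boundedFun.translate {K : Type*} [NormedAddCommGroup K] [NormedSpace ℝ K] (g : Γ) :
    boundedFun Γ K →ₗ[ℝ] boundedFun Γ K where
  toFun f := ⟨fun x => f.1 (g⁻¹ * x), f.2.imp fun _ hC x => hC (g⁻¹ * x)⟩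
  map_add' _ _ := rfl
  map_smul' _ _ := rfl

/-- The bounded functions with values in an inner product space, to be equipped with the
semi-inner product given by an invariant mean. -/
@[nolint unusedArguments]
def MeanSpace (_ : IsInvariantMean m) (K : Type*) [NormedAddCommGroup K]
    [InnerProductSpace ℝ K] : Type _ :=
  boundedFun Γ K

namespace MeanSpace

variable (hm : IsInvariantMean m) (K : Type*) [NormedAddCommGroup K] [InnerProductSpace ℝ K]

instance : AddCommGroup (MeanSpace hm K) := inferInstanceAs (AddCommGroup (boundedFun Γ K))
instance : Module ℝ (MeanSpace hm K) := inferInstanceAs (Module ℝ (boundedFun Γ K))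

/-- The identification of bounded functions with elements of `MeanSpace`. -/
def ofFun : boundedFun Γ K ≃ₗ[ℝ] MeanSpace hm K := LinearEquiv.refl ℝ _

/-- The semi-inner product on bounded functions given by an invariant mean. -/
noncomputable abbrev core : PreInnerProductSpace.Core ℝ (MeanSpace hm K) where
  inner f h := m fun x => ⟪((ofFun hm K).symm f).1 x, ((ofFun hm K).symm h).1 x⟫
  conj_inner_symm f h := by simp only [conj_trivial, real_inner_comm]
  re_inner_nonneg f := hm.nonneg _
    (inner_mem_boundedFun ((ofFun hm K).symm f).2 ((ofFun hm K).symm f).2)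
    fun _ => real_inner_self_nonneg
  add_left f g h := by
    rw [← hm.add _ _ (inner_mem_boundedFun (Subtype.prop _) (Subtype.prop _))
      (inner_mem_boundedFun (Subtype.prop _) (Subtype.prop _))]
    congr 1
    ext x
    simp [inner_add_left]
  smul_left f h r := by
    rw [conj_trivial, ← hm.smul _ _ (inner_mem_boundedFun (Subtype.prop _) (Subtype.prop _))]
    congr 1
    ext x
    simp [real_inner_smul_left]

noncomputable instance : SeminormedAddCommGroup (MeanSpace hm K) :=
  InnerProductSpace.Core.toSeminormedAddCommGroup (c := core hm K)

noncomputable instance : InnerProductSpace ℝ (MeanSpace hm K) :=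
  InnerProductSpace.ofCore (core hm K)

theorem norm_ofFun (f : boundedFun Γ K) :
    ‖ofFun hm K f‖ = Real.sqrt (m fun x => ⟪f.1 x, f.1 x⟫) :=
  rfl

theorem norm_translate (g : Γ) (f : boundedFun Γ K) :
    ‖ofFun hm K (boundedFun.translate g f)‖ = ‖ofFun hm K f‖ := by
  rw [norm_ofFun, norm_ofFun, ← hm.translate g⁻¹ _ (inner_mem_boundedFun f.2 f.2)]
  rfl

theorem norm_ofFun_le {f : boundedFun Γ K} {C : ℝ} (h : ∀ x, ‖f.1 x‖ ≤ C) :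
    ‖ofFun hm K f‖ ≤ C := by
  have hC : 0 ≤ C := (norm_nonneg _).trans (h 1)
  rw [norm_ofFun]
  refine Real.sqrt_le_iff.2 ⟨hC, hm.le_const (inner_mem_boundedFun f.2 f.2) fun x => ?_⟩
  rw [real_inner_self_eq_norm_sq]
  exact pow_le_pow_left₀ (norm_nonneg _) (h x) 2

theorem norm_ofFun_eq {f : boundedFun Γ K} {C : ℝ} (h : ∀ x, ‖f.1 x‖ = C) :
    ‖ofFun hm K f‖ = C := by
  have hC : 0 ≤ C := (norm_nonneg _).trans (h 1).le
  rw [norm_ofFun]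
  simp only [real_inner_self_eq_norm_sq, h, hm.const]
  exact Real.sqrt_sq hC

theorem exists_rep : ∃ π : Γ →* (UniformSpace.Completion (MeanSpace hm K) ≃ₗᵢ[ℝ]
    UniformSpace.Completion (MeanSpace hm K)), ∀ g (f : boundedFun Γ K),
      π g (ofFun hm K f : MeanSpace hm K) =
        (ofFun hm K (boundedFun.translate g f) : MeanSpace hm K) := by
  obtain ⟨π, hπ⟩ := exists_completion_action
    (fun g : Γ => (ofFun hm K).toLinearMap ∘ₗ boundedFun.translate g ∘ₗ
      (ofFun hm K).symm.toLinearMap)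
    (fun f => by
      change (⟨fun x => f.1 (1⁻¹ * x), _⟩ : boundedFun Γ K) = f
      ext x
      simp)
    (fun g h f => by
      change (⟨fun x => f.1 ((g * h)⁻¹ * x), _⟩ : boundedFun Γ K) =
        ⟨fun x => f.1 (h⁻¹ * (g⁻¹ * x)), _⟩
      ext x
      simp [mul_assoc])
    (fun g f => norm_translate hm K g ((ofFun hm K).symm f))
  exact ⟨π, fun g f => hπ g (ofFun hm K f)⟩

end MeanSpace

end GNS

section MatrixVector

/-- The linear identification of complex matrices with vectors of a real inner product space. -/
def matrixToL2 (n : ℕ) :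
    Matrix (Fin n) (Fin n) ℂ →ₗ[ℝ] PiLp 2 (fun _ : Fin n × Fin n => ℂ) where
  toFun A := WithLp.toLp 2 fun p => A p.1 p.2
  map_add' _ _ := rfl
  map_smul' _ _ := rfl

variable {n : ℕ}

theorem norm_matrixToL2_sq (A : Matrix (Fin n) (Fin n) ℂ) :
    ‖matrixToL2 n A‖ ^ 2 = (Matrix.trace (A * Aᴴ)).re := by
  rw [PiLp.norm_sq_eq_of_L2, Fintype.sum_prod_type]
  simp only [Matrix.trace, Matrix.diag, Matrix.mul_apply, Matrix.conjTranspose_apply,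
    Complex.re_sum]
  refine Finset.sum_congr rfl fun i _ => Finset.sum_congr rfl fun j _ => ?_
  change ‖A i j‖ ^ 2 = _
  rw [← Complex.normSq_eq_norm_sq]
  simp [Complex.normSq_apply]

theorem norm_matrixToL2_conjTranspose (A : Matrix (Fin n) (Fin n) ℂ) :
    ‖matrixToL2 n Aᴴ‖ = ‖matrixToL2 n A‖ := by
  rw [← sq_eq_sq₀ (norm_nonneg _) (norm_nonneg _), norm_matrixToL2_sq, norm_matrixToL2_sq,
    Matrix.conjTranspose_conjTranspose, Matrix.trace_mul_comm]

theorem norm_matrixToL2_conjTranspose_mul (U : Matrix.unitaryGroup (Fin n) ℂ)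
    (A : Matrix (Fin n) (Fin n) ℂ) :
    ‖matrixToL2 n ((U : Matrix (Fin n) (Fin n) ℂ)ᴴ * A)‖ = ‖matrixToL2 n A‖ := by
  rw [← sq_eq_sq₀ (norm_nonneg _) (norm_nonneg _), norm_matrixToL2_sq, norm_matrixToL2_sq,
    Matrix.trace_mul_comm, Matrix.conjTranspose_mul, Matrix.conjTranspose_conjTranspose]
  have h : (U : Matrix (Fin n) (Fin n) ℂ) * (U : Matrix (Fin n) (Fin n) ℂ)ᴴ = 1 :=
    Matrix.mem_unitaryGroup_iff.1 U.2
  rw [Matrix.mul_assoc, ← Matrix.mul_assoc _ _ A, h, Matrix.one_mul, Matrix.trace_mul_comm]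

theorem norm_matrixToL2_eq (hn : n ≠ 0) (A : Matrix (Fin n) (Fin n) ℂ) :
    ‖matrixToL2 n A‖ = Real.sqrt n * hsNorm A := by
  rw [hsNorm, ← norm_matrixToL2_sq, ← Real.sqrt_mul (Nat.cast_nonneg n), ← mul_assoc,
    mul_one_div_cancel (Nat.cast_ne_zero.2 hn), one_mul, Real.sqrt_sq (norm_nonneg _)]

end MatrixVector

theorem hsNorm_sub_one_le {Γ : Type*} [Group Γ] (ham : IsAmenable Γ)
    (htriv : ∀ (n : ℕ) (π : Γ →* Matrix.unitaryGroup (Fin n) ℂ) (g : Γ), π g = 1) {n : ℕ}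
    (hn : n ≠ 0) {φ : Γ → Matrix.unitaryGroup (Fin n) ℂ} {ε : ℝ}
    (hφ : ∀ g h : Γ, hsNorm ((φ g : Matrix (Fin n) (Fin n) ℂ) *
      (φ h : Matrix (Fin n) (Fin n) ℂ) - (φ (g * h) : Matrix (Fin n) (Fin n) ℂ)) ≤ ε) (g : Γ) :
    hsNorm ((φ g : Matrix (Fin n) (Fin n) ℂ) - 1) ≤ 3 * ε := by
  obtain ⟨m, hm⟩ := ham.exists_isInvariantMean
  let K := PiLp 2 (fun _ : Fin n × Fin n => ℂ)
  obtain ⟨π, hπ⟩ := MeanSpace.exists_rep hm K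
  let V : Matrix (Fin n) (Fin n) ℂ →ₗ[ℝ] boundedFun Γ K :=
    { toFun := fun W => ⟨fun x => matrixToL2 n ((φ x : Matrix (Fin n) (Fin n) ℂ)ᴴ * W),
        ‖matrixToL2 n W‖, fun x => (norm_matrixToL2_conjTranspose_mul _ _).le⟩
      map_add' := fun W W' => by
        ext1
        funext x
        change matrixToL2 n _ = matrixToL2 n _ + matrixToL2 n _
        rw [Matrix.mul_add, map_add]
      map_smul' := fun c W => by
        ext1
        funext x
        change matrixToL2 n _ = c • matrixToL2 n _
        rw [Matrix.mul_smul, map_smul] }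
  let ι : boundedFun Γ K →ₗ[ℝ] UniformSpace.Completion (MeanSpace hm K) :=
    (UniformSpace.Completion.toComplₗᵢ (𝕜 := ℝ)).toLinearMap ∘ₗ (MeanSpace.ofFun hm K).toLinearMap
  have hι (f : boundedFun Γ K) : ‖ι f‖ = ‖MeanSpace.ofFun hm K f‖ :=
    UniformSpace.Completion.norm_coe _
  have hιV (W : Matrix (Fin n) (Fin n) ℂ) : ‖ι (V W)‖ = ‖matrixToL2 n W‖ := by
    rw [hι]
    exact MeanSpace.norm_ofFun_eq hm K (f := V W) fun x =>
      norm_matrixToL2_conjTranspose_mul (φ x) W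
  have hπι (g : Γ) (f : boundedFun Γ K) : π g (ι f) = ι (boundedFun.translate g f) := hπ g f
  have hnear (x : Γ) : ‖ι (V 1) - π x (ι (V (φ x : Matrix (Fin n) (Fin n) ℂ)ᴴ))‖ ≤
      Real.sqrt n * ε := by
    rw [hπι, ← map_sub, hι]
    refine MeanSpace.norm_ofFun_le hm K fun y => ?_
    change ‖matrixToL2 n _ - matrixToL2 n _‖ ≤ _
    rw [← map_sub, Matrix.mul_one, ← Matrix.conjTranspose_mul, ← Matrix.conjTranspose_sub,
      norm_matrixToL2_conjTranspose, ← norm_neg, ← map_neg, neg_sub, norm_matrixToL2_eq hn]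
    have := hφ x (x⁻¹ * y)
    rw [mul_inv_cancel_left] at this
    exact mul_le_mul_of_nonneg_left this (Real.sqrt_nonneg _)
  have hfix := norm_map_sub_le_of_near_translates htriv hm π (LinearMap.range (ι ∘ₗ V))
    (fun x => ⟨_, ⟨(φ x : Matrix (Fin n) (Fin n) ℂ)ᴴ, rfl⟩, hnear x⟩) g
  have h1 : ‖ι (V ((φ g : Matrix (Fin n) (Fin n) ℂ) - 1)ᴴ)‖ =
      Real.sqrt n * hsNorm ((φ g : Matrix (Fin n) (Fin n) ℂ) - 1) := by
    rw [hιV, norm_matrixToL2_conjTranspose, norm_matrixToL2_eq hn]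
  have h2 : ‖ι (V ((φ g : Matrix (Fin n) (Fin n) ℂ) - 1)ᴴ)‖ ≤ 3 * (Real.sqrt n * ε) := by
    rw [Matrix.conjTranspose_sub, Matrix.conjTranspose_one, map_sub, map_sub,
      ← (π g).norm_map, map_sub, norm_sub_rev]
    refine (norm_sub_le_norm_sub_add_norm_sub _ (ι (V 1)) _).trans ?_
    linarith [hnear g]
  rw [h1] at h2
  have hpos : 0 < Real.sqrt n := Real.sqrt_pos.2 (Nat.cast_pos.2 (Nat.pos_of_ne_zero hn))
  refine le_of_mul_le_mul_left ?_ hpos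
  linarith

/-- A countable amenable group all of whose finite dimensional unitary
representations are trivial is uniformly HS stable. -/
theorem stmt_11 (Γ : Type*) [Group Γ] [Countable Γ] (ham : IsAmenable Γ)
    (htriv : ∀ (n : ℕ) (π : Γ →* Matrix.unitaryGroup (Fin n) ℂ) (g : Γ), π g = 1) :
    UniformlyHSStable Γ := by
  intro δ hδ
  refine ⟨δ / 4, by positivity, fun n φ hφ => ⟨1, fun g => ?_⟩⟩
  rcases eq_or_ne n 0 with rfl | hn
  · simpa [hsNorm] using hδ
  · have h := hsNorm_sub_one_le ham htriv hn (fun g h => (hφ g h).le) g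
    rw [MonoidHom.one_apply, Matrix.UnitaryGroup.one_val]
    linarith
end

section
/- If a finitely generated residually finite group Γ is uniformly HS stable, then Γ is virtually abelian. -/
open scoped Matrix

namespace HSStability

open scoped Matrix.Norms.Frobenius

section Norm

variable {ι κ : Type*} [Fintype ι] [Fintype κ]

lemma norm_sq_eq_sum (A : Matrix ι κ ℂ) : ‖A‖ ^ 2 = ∑ i, ∑ j, ‖A i j‖ ^ 2 := by
  rw [Matrix.frobenius_norm_def, ← Real.sqrt_eq_rpow, Real.sq_sqrt (by positivity)]
  simp

lemma norm_sq_eq_trace (A : Matrix ι κ ℂ) : ‖A‖ ^ 2 = (A * Aᴴ).trace.re := by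
  simp only [norm_sq_eq_sum, Matrix.trace, Matrix.diag_apply, Matrix.mul_apply,
    Matrix.conjTranspose_apply, RCLike.star_def, Complex.mul_conj, Complex.normSq_eq_norm_sq,
    Complex.re_sum, Complex.ofReal_re]

lemma hsNorm_eq {n m : ℕ} (A : Matrix (Fin n) (Fin m) ℂ) : hsNorm A = ‖A‖ / √n := by
  rw [hsNorm, ← norm_sq_eq_trace, one_div_mul_eq_div, Real.sqrt_div (sq_nonneg _),
    Real.sqrt_sq (norm_nonneg _)]

lemma norm_mul_unitary [DecidableEq κ] (A : Matrix ι κ ℂ) (U : Matrix.unitaryGroup κ ℂ) :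
    ‖A * (U : Matrix κ κ ℂ)‖ = ‖A‖ := by
  rw [← sq_eq_sq₀ (norm_nonneg _) (norm_nonneg _), norm_sq_eq_trace, norm_sq_eq_trace,
    Matrix.conjTranspose_mul, Matrix.mul_assoc, ← Matrix.mul_assoc (U : Matrix κ κ ℂ),
    ← Matrix.star_eq_conjTranspose (U : Matrix κ κ ℂ), Matrix.mem_unitaryGroup_iff.1 U.2,
    Matrix.one_mul]

lemma norm_unitary_mul [DecidableEq ι] (U : Matrix.unitaryGroup ι ℂ) (A : Matrix ι κ ℂ) :
    ‖(U : Matrix ι ι ℂ) * A‖ = ‖A‖ := by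
  rw [← Matrix.frobenius_norm_conjTranspose, Matrix.conjTranspose_mul,
    ← Matrix.star_eq_conjTranspose, ← Unitary.coe_star, norm_mul_unitary,
    Matrix.frobenius_norm_conjTranspose]

lemma norm_parallelogram (A B : Matrix ι κ ℂ) :
    ‖A + B‖ ^ 2 + ‖A - B‖ ^ 2 = 2 * (‖A‖ ^ 2 + ‖B‖ ^ 2) := by
  simp only [norm_sq_eq_trace, Matrix.conjTranspose_add, Matrix.conjTranspose_sub, Matrix.add_mul,
    Matrix.mul_add, Matrix.sub_mul, Matrix.mul_sub, Matrix.trace_add, Matrix.trace_sub,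
    Complex.add_re, Complex.sub_re]
  ring

lemma norm_fromBlocks_le {ι' κ' : Type*} [Fintype ι'] [Fintype κ'] (A : Matrix ι κ ℂ)
    (B : Matrix ι κ' ℂ) (C : Matrix ι' κ ℂ) (D : Matrix ι' κ' ℂ) :
    ‖Matrix.fromBlocks A B C D‖ ≤ ‖A‖ + ‖B‖ + ‖C‖ + ‖D‖ := by
  refine (sq_le_sq₀ (norm_nonneg _) (by positivity)).1 ?_
  have h : ‖Matrix.fromBlocks A B C D‖ ^ 2 = ‖A‖ ^ 2 + ‖B‖ ^ 2 + ‖C‖ ^ 2 + ‖D‖ ^ 2 := by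
    simp only [norm_sq_eq_sum, Fintype.sum_sum_type, Matrix.fromBlocks_apply₁₁,
      Matrix.fromBlocks_apply₁₂, Matrix.fromBlocks_apply₂₁, Matrix.fromBlocks_apply₂₂,
      Finset.sum_add_distrib]
    ring
  rw [h]
  have := norm_nonneg A; have := norm_nonneg B; have := norm_nonneg C; have := norm_nonneg D
  have : 0 ≤ ‖A‖ * ‖B‖ + ‖A‖ * ‖C‖ + ‖A‖ * ‖D‖ + ‖B‖ * ‖C‖ + ‖B‖ * ‖D‖ + ‖C‖ * ‖D‖ := by
    positivity
  nlinarith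

lemma norm_fromBlocks_zero {ι' κ' : Type*} [Fintype ι'] [Fintype κ'] (A : Matrix ι κ ℂ) :
    ‖Matrix.fromBlocks A (0 : Matrix ι κ' ℂ) (0 : Matrix ι' κ ℂ) 0‖ = ‖A‖ := by
  rw [← sq_eq_sq₀ (norm_nonneg _) (norm_nonneg _)]
  simp [norm_sq_eq_sum]

/-- A matrix whose orbit under the isometric action `A ↦ U g * A * V g` stays within `r` of itself
is within `r` of a fixed point of the action. -/
lemma exists_fixed_near {G : Type*} [Group G] [DecidableEq ι] [DecidableEq κ]
    (ρ : G →* Matrix.unitaryGroup ι ℂ) (π : G →* Matrix.unitaryGroup κ ℂ) (A : Matrix ι κ ℂ)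
    (r : ℝ) (hA : ∀ g, ‖(ρ g : Matrix ι ι ℂ) * A - A * (π g : Matrix κ κ ℂ)‖ ≤ r) :
    ∃ T : Matrix ι κ ℂ, ‖T - A‖ ≤ r ∧
      ∀ g, (ρ g : Matrix ι ι ℂ) * T = T * (π g : Matrix κ κ ℂ) := by
  let L : G → Matrix ι κ ℂ → Matrix ι κ ℂ := fun g X => (ρ g).1 * X * (π g⁻¹).1
  have L_mul (g h : G) (X : Matrix ι κ ℂ) : L (g * h) X = L g (L h X) := by
    simp only [L, mul_inv_rev, map_mul, Submonoid.coe_mul, Matrix.mul_assoc]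
  have L_one (X : Matrix ι κ ℂ) : L 1 X = X := by simp [L]
  have L_sub (g : G) (X Y : Matrix ι κ ℂ) : L g (X - Y) = L g X - L g Y := by
    simp only [L, Matrix.mul_sub, Matrix.sub_mul]
  have L_norm (g : G) (X : Matrix ι κ ℂ) : ‖L g X‖ = ‖X‖ := by
    simp only [L, norm_mul_unitary, norm_unitary_mul]
  have inter (g : G) (X : Matrix ι κ ℂ) : L g X * (π g).1 = (ρ g).1 * X := by
    simp only [L, Matrix.mul_assoc, ← Submonoid.coe_mul, ← map_mul]
    simp
  let C : Set (Matrix ι κ ℂ) := ⋂ g, Metric.closedBall (L g A) r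
  have C_inv (g : G) (X : Matrix ι κ ℂ) (hX : X ∈ C) : L g X ∈ C := by
    simp only [C, Set.mem_iInter, Metric.mem_closedBall, dist_eq_norm] at hX ⊢
    intro h
    rw [← mul_inv_cancel_left g h, L_mul, ← L_sub, L_norm]
    exact hX _
  have A_mem : A ∈ C := by
    simp only [C, Set.mem_iInter, Metric.mem_closedBall, dist_eq_norm]
    intro g
    rw [norm_sub_rev, ← norm_mul_unitary _ (π g), Matrix.sub_mul, inter]
    exact hA g
  have C_convex : Convex ℝ C := convex_iInter fun g => convex_closedBall _ _
  have C_compact : IsCompact C := by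
    have : ProperSpace (Matrix ι κ ℂ) := FiniteDimensional.proper ℂ _
    exact (isCompact_closedBall (L 1 A) r).of_isClosed_subset
      (isClosed_iInter fun g => Metric.isClosed_closedBall) (Set.iInter_subset _ 1)
  obtain ⟨T, hT, hmin⟩ := C_compact.exists_isMinOn ⟨A, A_mem⟩ continuous_norm.continuousOn
  refine ⟨T, ?_, fun g => ?_⟩
  · have := Set.mem_iInter.1 hT 1
    rwa [L_one, Metric.mem_closedBall, dist_eq_norm] at this
  · have hmid : ‖T‖ ≤ ‖(1 / 2 : ℝ) • T + (1 / 2 : ℝ) • L g T‖ :=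
      hmin (C_convex hT (C_inv g T hT) (by norm_num) (by norm_num) (by norm_num))
    rw [← smul_add, norm_smul, Real.norm_of_nonneg (by norm_num : (0 : ℝ) ≤ 1 / 2)] at hmid
    have hpar := norm_parallelogram T (L g T)
    rw [L_norm] at hpar
    have h0 : ‖T - L g T‖ ^ 2 ≤ 0 := by nlinarith [norm_nonneg T]
    have h1 : T - L g T = 0 := by
      rw [← norm_eq_zero]
      exact pow_eq_zero_iff two_ne_zero |>.1 (le_antisymm h0 (sq_nonneg _))
    rw [← inter, ← sub_eq_zero.1 h1]

end Norm

section Compression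

lemma exists_feedback_gain (d : ℂ) : ∃ k : ℂ, ‖k‖ ≤ 1 ∧
    1 + k * d + star k * star d = star k * k * (1 - star d * d) := by
  rcases eq_or_ne d 0 with rfl | hd
  · exact ⟨1, by simp⟩
  have hd' : (‖d‖ : ℂ) ≠ 0 := by simpa using hd
  have h1 : (1 + ‖d‖ : ℂ) ≠ 0 := by
    have : (1 + ‖d‖ : ℝ) ≠ 0 := by positivity
    exact_mod_cast this
  have hdd : star d * d = (‖d‖ : ℂ) ^ 2 := Complex.conj_mul' d
  refine ⟨-star d / (‖d‖ * (1 + ‖d‖)), ?_, ?_⟩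
  · have : ‖(1 + ‖d‖ : ℂ)‖ = 1 + ‖d‖ := by
      rw [← Complex.ofReal_one, ← Complex.ofReal_add, Complex.norm_of_nonneg (by positivity)]
    rw [norm_div, norm_mul, norm_neg, norm_star, this, Complex.norm_real, norm_norm,
      div_mul_eq_div_div, div_self (norm_ne_zero_iff.2 hd)]
    exact div_le_one_of_le₀ (by linarith [norm_nonneg d]) (by positivity)
  · have hk : star (-star d / (‖d‖ * (1 + ‖d‖)) : ℂ) = -d / (‖d‖ * (1 + ‖d‖)) := by
      simp
    rw [hk]
    have e1 : -star d / (‖d‖ * (1 + ‖d‖)) * d = -(‖d‖ : ℂ) / (1 + ‖d‖) := by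
      rw [div_mul_eq_mul_div, neg_mul, hdd]; field_simp
    have e2 : -d / (‖d‖ * (1 + ‖d‖)) * star d = -(‖d‖ : ℂ) / (1 + ‖d‖) := by
      rw [div_mul_eq_mul_div, neg_mul, mul_comm, hdd]; field_simp
    have e3 : -d / (‖d‖ * (1 + ‖d‖)) * (-star d / (‖d‖ * (1 + ‖d‖))) = 1 / (1 + ‖d‖ : ℂ) ^ 2 := by
      rw [div_mul_div_comm, neg_mul_neg, mul_comm d, hdd]; field_simp
    rw [e1, e2, e3, hdd]
    field_simp
    ring

/-- Every unitary matrix of size `m + 1` is, up to a bounded Frobenius error, the direct sum of a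
unitary matrix of size `m` and `1`. -/
lemma exists_unitary_compression {m : ℕ} (U : Matrix.unitaryGroup (Fin m ⊕ Unit) ℂ) :
    ∃ V : Matrix.unitaryGroup (Fin m) ℂ,
      ‖Matrix.fromBlocks (V : Matrix (Fin m) (Fin m) ℂ) 0 0 (1 : Matrix Unit Unit ℂ)
        - (U : Matrix (Fin m ⊕ Unit) (Fin m ⊕ Unit) ℂ)‖ ≤ 5 := by
  obtain ⟨A, b, c, D, hU⟩ : ∃ A b c D, (U : Matrix (Fin m ⊕ Unit) (Fin m ⊕ Unit) ℂ)
      = Matrix.fromBlocks A b c D := ⟨_, _, _, _, (Matrix.fromBlocks_toBlocks _).symm⟩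
  have h1 : U.1ᴴ * U.1 = 1 :=
    Matrix.mem_unitaryGroup_iff'.1 U.2
  have h2 : U.1 * U.1ᴴ = 1 :=
    Matrix.mem_unitaryGroup_iff.1 U.2
  rw [hU, Matrix.fromBlocks_conjTranspose, Matrix.fromBlocks_multiply, ← Matrix.fromBlocks_one,
    Matrix.fromBlocks_inj] at h1 h2
  obtain ⟨hAA, hAb, hbA, hbb⟩ := h1
  obtain ⟨-, -, -, hcc⟩ := h2
  obtain ⟨d, rfl⟩ : ∃ d : ℂ, D = d • (1 : Matrix Unit Unit ℂ) :=
    ⟨D () (), by ext ⟨⟩ ⟨⟩; simp⟩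
  obtain ⟨k, hk, hkd⟩ := exists_feedback_gain d
  have hone : ‖(1 : Matrix Unit Unit ℂ)‖ = 1 := by
    rw [← sq_eq_sq₀ (norm_nonneg _) zero_le_one]; simp [norm_sq_eq_sum]
  have hc1 : ‖c‖ ^ 2 + ‖d‖ ^ 2 = 1 := by
    have := congrArg (fun M => (Matrix.trace M).re) hcc
    simp only [Matrix.trace_add, Complex.add_re, ← norm_sq_eq_trace, norm_smul, hone] at this
    simpa using this
  have hb1 : ‖b‖ ^ 2 + ‖d‖ ^ 2 = 1 := by
    have := congrArg (fun M => (Matrix.trace M).re) hbb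
    have e : bᴴ * b = bᴴ * bᴴᴴ := by simp
    have e' (M : Matrix Unit Unit ℂ) : Mᴴ * M = Mᴴ * Mᴴᴴ := by simp
    rw [e, e'] at this
    simp only [Matrix.trace_add, Complex.add_re, ← norm_sq_eq_trace, norm_smul, hone,
      Matrix.frobenius_norm_conjTranspose] at this
    simpa using this
  have hb : ‖b‖ ≤ 1 := by nlinarith [sq_nonneg ‖d‖, norm_nonneg b]
  have hc : ‖c‖ ≤ 1 := by nlinarith [sq_nonneg ‖d‖, norm_nonneg c]
  have hd : ‖d‖ ≤ 1 := by nlinarith [sq_nonneg ‖c‖, norm_nonneg d]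
  have hV : A + k • (b * c) ∈ Matrix.unitaryGroup (Fin m) ℂ := by
    rw [Matrix.mem_unitaryGroup_iff', Matrix.star_eq_conjTranspose]
    have r1 : Aᴴ * A = 1 - cᴴ * c := eq_sub_of_add_eq hAA
    have r2 : Aᴴ * (b * c) = -d • (cᴴ * c) := by
      rw [← Matrix.mul_assoc, eq_neg_of_add_eq_zero_left hAb]
      simp
    have r3 : cᴴ * bᴴ * A = -star d • (cᴴ * c) := by
      rw [Matrix.mul_assoc, eq_neg_of_add_eq_zero_left hbA]
      simp
    have r4 : cᴴ * bᴴ * (b * c) = (1 - star d * d) • (cᴴ * c) := by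
      rw [Matrix.mul_assoc, ← Matrix.mul_assoc bᴴ, eq_sub_of_add_eq hbb]
      simp [Matrix.sub_mul, Matrix.mul_sub, sub_smul, smul_smul, mul_comm]
    simp only [Matrix.conjTranspose_add, Matrix.conjTranspose_smul, Matrix.conjTranspose_mul,
      Matrix.add_mul, Matrix.mul_add, Matrix.smul_mul, Matrix.mul_smul, r1, r2, r3, r4, smul_smul]
    have : (1 : Matrix (Fin m) (Fin m) ℂ) = 1 - (1 + k * d + star k * star d
        - star k * k * (1 - star d * d)) • (cᴴ * c) := by rw [hkd]; simp
    refine Eq.trans ?_ this.symm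
    module
  refine ⟨⟨_, hV⟩, ?_⟩
  rw [hU, sub_eq_add_neg, Matrix.fromBlocks_neg, Matrix.fromBlocks_add]
  simp only [← sub_eq_add_neg]
  refine (norm_fromBlocks_le _ _ _ _).trans ?_
  have e1 : ‖A + k • (b * c) - A‖ ≤ 1 := by
    rw [add_sub_cancel_left, norm_smul]
    exact mul_le_one₀ hk (norm_nonneg _)
      ((Matrix.frobenius_norm_mul b c).trans (mul_le_one₀ hb (norm_nonneg _) hc))
  have e2 : ‖(1 : Matrix Unit Unit ℂ) - d • 1‖ ≤ 2 := by
    refine (norm_sub_le _ _).trans ?_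
    rw [norm_smul, hone]
    linarith
  simp only [zero_sub, norm_neg]
  linarith

end Compression

section DimensionBound

variable {Γ : Type*} [Group Γ]

lemma norm_submatrix_inl_le {ι ι' κ : Type*} [Fintype ι] [Fintype ι'] [Fintype κ]
    (X : Matrix (ι ⊕ ι') κ ℂ) : ‖X.submatrix Sum.inl id‖ ≤ ‖X‖ := by
  rw [← sq_le_sq₀ (norm_nonneg _) (norm_nonneg _), norm_sq_eq_sum, norm_sq_eq_sum,
    Fintype.sum_sum_type]
  exact le_add_of_nonneg_right (by positivity)

/-- A homomorphism into `U(m + 1)` of a group whose `15 / √m`-homomorphisms into `U(m)` are close to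
representations is intertwined with a representation in dimension `m`. -/
lemma exists_intertwiner {m : ℕ} {ε : ℝ} (hm : 100 < m) (hε : 15 / √(m : ℝ) < ε)
    (hstab : ∀ φ : Γ → Matrix.unitaryGroup (Fin m) ℂ,
      (∀ g h : Γ, hsNorm ((φ g : Matrix (Fin m) (Fin m) ℂ) * (φ h : Matrix (Fin m) (Fin m) ℂ)
        - (φ (g * h) : Matrix (Fin m) (Fin m) ℂ)) < ε) →
      ∃ ρ : Γ →* Matrix.unitaryGroup (Fin m) ℂ,
        ∀ g, hsNorm ((φ g : Matrix (Fin m) (Fin m) ℂ) - (ρ g : Matrix (Fin m) (Fin m) ℂ)) < 1 / 2)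
    (π : Γ →* Matrix.unitaryGroup (Fin m ⊕ Unit) ℂ) :
    ∃ (ρ : Γ →* Matrix.unitaryGroup (Fin m) ℂ) (T : Matrix (Fin m) (Fin m ⊕ Unit) ℂ), T ≠ 0 ∧
      ∀ g, (ρ g : Matrix (Fin m) (Fin m) ℂ) * T = T * (π g).1 := by
  let stab (V : Matrix (Fin m) (Fin m) ℂ) : Matrix (Fin m ⊕ Unit) (Fin m ⊕ Unit) ℂ :=
    Matrix.fromBlocks V 0 0 1
  have stab_mul (V W : Matrix (Fin m) (Fin m) ℂ) : stab V * stab W = stab (V * W) := by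
    simp [stab, Matrix.fromBlocks_multiply]
  have norm_stab_sub (V W : Matrix (Fin m) (Fin m) ℂ) : ‖stab V - stab W‖ = ‖V - W‖ := by
    simp [stab, sub_eq_add_neg, Matrix.fromBlocks_neg, Matrix.fromBlocks_add,
      norm_fromBlocks_zero]
  have stab_unitary (V : Matrix.unitaryGroup (Fin m) ℂ) :
      stab V ∈ Matrix.unitaryGroup (Fin m ⊕ Unit) ℂ := by
    rw [Matrix.mem_unitaryGroup_iff', Matrix.star_eq_conjTranspose, Matrix.fromBlocks_conjTranspose,
      Matrix.fromBlocks_multiply]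
    simp [← Matrix.star_eq_conjTranspose]
  choose φ hφ using fun g => exists_unitary_compression (π g)
  change ∀ g, ‖stab (φ g) - (π g).1‖ ≤ 5 at hφ
  have hm0 : 0 < √(m : ℝ) := Real.sqrt_pos.2 (by exact_mod_cast (by omega : 0 < m))
  have hm10 : 10 < √(m : ℝ) := by
    rw [Real.lt_sqrt (by norm_num)]
    norm_num
    exact_mod_cast hm
  obtain ⟨ρ, hρ⟩ := hstab φ fun g h => by
    rw [hsNorm_eq]
    refine lt_of_le_of_lt ?_ hε
    gcongr
    rw [← norm_stab_sub, ← stab_mul]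
    have e : stab (φ g) * stab (φ h) - stab (φ (g * h))
        = stab (φ g) * (stab (φ h) - (π h).1)
          + (stab (φ g) - (π g).1) * (π h).1
          - (stab (φ (g * h)) - (π (g * h)).1) := by
      rw [map_mul, Submonoid.coe_mul]
      noncomm_ring
    rw [e]
    have h1 : ‖stab (φ g) * (stab (φ h) - (π h).1)‖ ≤ 5 :=
      (norm_unitary_mul ⟨_, stab_unitary (φ g)⟩ _).trans_le (hφ h)
    have h2 : ‖(stab (φ g) - (π g).1) * (π h).1‖ ≤ 5 :=
      (norm_mul_unitary _ _).trans_le (hφ g)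
    have h3 := hφ (g * h)
    refine (norm_sub_le _ _).trans ?_
    linarith [norm_add_le (stab (φ g) * (stab (φ h) - (π h).1))
      ((stab (φ g) - (π g).1) * (π h).1)]
  let P : Matrix (Fin m) (Fin m ⊕ Unit) ℂ :=
    (1 : Matrix (Fin m ⊕ Unit) (Fin m ⊕ Unit) ℂ).submatrix Sum.inl id
  have P_mul (X : Matrix (Fin m ⊕ Unit) (Fin m ⊕ Unit) ℂ) : P * X = X.submatrix Sum.inl id := by
    have := Matrix.submatrix_mul (1 : Matrix (Fin m ⊕ Unit) (Fin m ⊕ Unit) ℂ) X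
      Sum.inl id id Function.bijective_id
    simpa [P] using this.symm
  have mul_P (V : Matrix (Fin m) (Fin m) ℂ) : V * P = P * stab V := by
    rw [P_mul]
    ext i (j | j) <;> simp [P, stab, Matrix.mul_apply, Matrix.one_apply]
  have norm_P : ‖P‖ = √m := by
    rw [← sq_eq_sq₀ (norm_nonneg _) (Real.sqrt_nonneg _), norm_sq_eq_sum, Real.sq_sqrt (by simp)]
    simp [P, Matrix.one_apply, apply_ite, ite_pow]
  obtain ⟨T, hT, hTπ⟩ := exists_fixed_near ρ π P (√m / 2 + 5) fun g => by
    rw [mul_P, ← Matrix.mul_sub, P_mul]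
    refine (norm_submatrix_inl_le _).trans ?_
    have h1 : ‖stab (ρ g) - stab (φ g)‖ ≤ √m / 2 := by
      have := hρ g
      rw [hsNorm_eq, div_lt_iff₀ hm0] at this
      rw [norm_stab_sub, norm_sub_rev]
      linarith
    rw [← sub_add_sub_cancel _ (stab (φ g))]
    exact (norm_add_le _ _).trans (add_le_add h1 (hφ g))
  refine ⟨ρ, T, ?_, hTπ⟩
  rintro rfl
  rw [zero_sub, norm_neg, norm_P] at hT
  linarith

/-- Relabelling the coordinates of a unitary matrix. -/
def reindexUnitary {ι κ : Type*} [Fintype ι] [DecidableEq ι] [Fintype κ] [DecidableEq κ]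
    (e : ι ≃ κ) : Matrix.unitaryGroup ι ℂ →* Matrix.unitaryGroup κ ℂ where
  toFun U := ⟨(U : Matrix ι ι ℂ).submatrix e.symm e.symm, by
    rw [Matrix.mem_unitaryGroup_iff', Matrix.star_eq_conjTranspose, Matrix.conjTranspose_submatrix,
      Matrix.submatrix_mul_equiv, ← Matrix.star_eq_conjTranspose,
      Matrix.mem_unitaryGroup_iff'.1 U.2, Matrix.submatrix_one_equiv]⟩
  map_one' := Subtype.ext (by simp)
  map_mul' U V := Subtype.ext (by simp [Matrix.submatrix_mul_equiv])

/-- The irreducible representations of a uniformly HS stable group have bounded dimension. -/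
lemma exists_dim_bound (hstab : UniformlyHSStable Γ) :
    ∃ D : ℕ, ∀ (n : ℕ) (π : Γ →* Matrix.unitaryGroup (Fin n) ℂ), IsIrreducibleRep π → n ≤ D := by
  obtain ⟨ε, hε, hstab⟩ := hstab (1 / 2) (by norm_num)
  obtain ⟨k, hk⟩ := exists_nat_gt ((15 / ε) ^ 2)
  refine ⟨max 101 k, fun n π hπ => ?_⟩
  by_contra! hn
  obtain ⟨m, rfl⟩ : ∃ m, n = m + 1 := ⟨n - 1, by omega⟩
  have hm : 100 < m := by omega
  have hkm : (k : ℝ) ≤ m := by exact_mod_cast (by omega : k ≤ m)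
  have hmε : 15 / √(m : ℝ) < ε := by
    have : 15 / ε < √(m : ℝ) := Real.lt_sqrt_of_sq_lt (hk.trans_le hkm)
    rwa [div_lt_comm₀ (Real.sqrt_pos.2 (by exact_mod_cast (by omega : 0 < m))) hε]
  let e : Fin (m + 1) ≃ Fin m ⊕ Unit := Fintype.equivOfCardEq (by simp)
  obtain ⟨ρ, T, hT, hTπ⟩ := exists_intertwiner hm hmε (hstab m) ((reindexUnitary e).comp π)
  have hTπ' (g : Γ) : T.submatrix id e * (π g : Matrix (Fin (m + 1)) (Fin (m + 1)) ℂ)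
      = (ρ g : Matrix (Fin m) (Fin m) ℂ) * T.submatrix id e := by
    have := congrArg (fun M => M.submatrix id e) (hTπ g)
    simp only [reindexUnitary, MonoidHom.comp_apply, MonoidHom.coe_mk, OneHom.coe_mk] at this
    rw [← Matrix.submatrix_mul_equiv _ _ id e e] at this
    simpa [Matrix.submatrix_mul _ _ id id e Function.bijective_id] using this.symm
  rcases hπ (LinearMap.ker (T.submatrix id e).mulVecLin) fun g v hv => by
    rw [LinearMap.mem_ker, Matrix.mulVecLin_apply] at hv ⊢
    rw [Matrix.mulVec_mulVec, hTπ', ← Matrix.mulVec_mulVec, hv, Matrix.mulVec_zero] with h | h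
  · exact LinearMap.ker_ne_bot_of_finrank_lt (by simp) h
  · rw [LinearMap.ker_eq_top] at h
    have h0 : T.submatrix id e = 0 :=
      Matrix.mulVec_injective (funext fun v => by simpa using LinearMap.congr_fun h v)
    apply hT
    simpa using congrArg (fun M => M.submatrix id e.symm) h0

end DimensionBound

section Jordan

open scoped commutatorElement

lemma eq_one_of_norm_pow_sub_one_lt {R : Type*} [NormedRing R] [NormedAlgebra ℝ R]
    [CompleteSpace R] {c : R} (hc : ∀ k : ℕ, ‖c ^ k - 1‖ < 1) {m : ℕ} (hm : 0 < m)
    (hcm : c ^ m = 1) : c = 1 := by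
  have hm' : (m : ℝ) ≠ 0 := by positivity
  let P : R := (m : ℝ)⁻¹ • ∑ k ∈ Finset.range m, c ^ k
  have hP : 1 - P = (m : ℝ)⁻¹ • ∑ k ∈ Finset.range m, (1 - c ^ k) := by
    rw [Finset.sum_sub_distrib, smul_sub, Finset.sum_const, Finset.card_range,
      ← Nat.cast_smul_eq_nsmul ℝ, smul_smul, inv_mul_cancel₀ hm', one_smul]
  have hP1 : ‖1 - P‖ < 1 := by
    rw [hP, norm_smul, norm_inv, Real.norm_natCast, inv_mul_lt_one₀ (by positivity)]
    refine (norm_sum_le _ _).trans_lt ?_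
    refine (Finset.sum_lt_sum_of_nonempty (by simpa using hm.ne')
      (g := fun _ => (1 : ℝ)) fun k _ => ?_).trans_eq (by simp)
    rw [norm_sub_rev]
    exact hc k
  have hunit : IsUnit P := by
    simpa using isUnit_one_sub_of_norm_lt_one hP1
  have hmul : (c - 1) * P = 0 := by
    rw [mul_smul_comm, mul_geom_sum, hcm, sub_self, smul_zero]
  exact sub_eq_zero.1 (hunit.mul_left_eq_zero.1 hmul)

variable {ι : Type*} [Fintype ι] [DecidableEq ι]

lemma norm_commutator_sub_one (A B : Matrix.unitaryGroup ι ℂ) :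
    ‖(⁅A, B⁆).1 - 1‖ = ‖A.1 * B.1 - B.1 * A.1‖ := by
  rw [← norm_mul_unitary _ (B * A), Matrix.sub_mul, ← Submonoid.coe_mul, commutatorElement_def]
  simp [mul_assoc]

lemma norm_commutator_le (A B : Matrix.unitaryGroup ι ℂ) :
    ‖(⁅A, B⁆).1 - 1‖ ≤ 2 * ‖A.1 - 1‖ * ‖B.1 - 1‖ := by
  have : A.1 * B.1 - B.1 * A.1 = (A.1 - 1) * (B.1 - 1) - (B.1 - 1) * (A.1 - 1) := by
    noncomm_ring
  rw [norm_commutator_sub_one, this]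
  refine (norm_sub_le _ _).trans ?_
  linarith [Matrix.frobenius_norm_mul (A.1 - 1) (B.1 - 1),
    Matrix.frobenius_norm_mul (B.1 - 1) (A.1 - 1), mul_comm ‖A.1 - 1‖ ‖B.1 - 1‖]

lemma norm_commutator_le_right (A B : Matrix.unitaryGroup ι ℂ) :
    ‖(⁅A, B⁆).1 - 1‖ ≤ 2 * ‖B.1 - 1‖ := by
  have : A.1 * B.1 - B.1 * A.1 = A.1 * (B.1 - 1) - (B.1 - 1) * A.1 := by
    noncomm_ring
  rw [norm_commutator_sub_one, this]
  refine (norm_sub_le _ _).trans ?_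
  rw [norm_mul_unitary, norm_unitary_mul]
  linarith

lemma commutator_pow {G : Type*} [Group G] {a b : G} (h : Commute a ⁅a, b⁆) (k : ℕ) :
    ⁅a ^ k, b⁆ = ⁅a, b⁆ ^ k := by
  induction k with
  | zero => simp
  | succ k ih =>
    have : ⁅a ^ (k + 1), b⁆ = a * ⁅a ^ k, b⁆ * a⁻¹ * ⁅a, b⁆ := by
      simp only [commutatorElement_def]
      group
    rw [this, ih, (h.pow_right k).eq, mul_inv_cancel_right, pow_succ]

/-- A weak form of Frobenius' lemma on commuting commutators. -/
lemma commutator_eq_one {A B : Matrix.unitaryGroup ι ℂ} (hB : ‖B.1 - 1‖ < 1 / 2)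
    (hfin : IsOfFinOrder ⁅A, B⁆) (hcomm : Commute A ⁅A, B⁆) : ⁅A, B⁆ = 1 := by
  obtain ⟨m, hm, hpow⟩ := isOfFinOrder_iff_pow_eq_one.1 hfin
  have : CompleteSpace (Matrix ι ι ℂ) := FiniteDimensional.complete ℂ _
  refine Subtype.ext (eq_one_of_norm_pow_sub_one_lt (fun k => ?_) hm ?_)
  · rw [← SubmonoidClass.coe_pow, ← commutator_pow hcomm]
    linarith [norm_commutator_le_right (A ^ k) B]
  · rw [← SubmonoidClass.coe_pow, hpow, OneMemClass.coe_one]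

lemma isOfFinOrder_of_mem_finite {G : Type*} [Group G] (H : Subgroup G) [Finite H] {g : G}
    (hg : g ∈ H) : IsOfFinOrder g :=
  H.subtype.isOfFinOrder (isOfFinOrder_of_finite (⟨g, hg⟩ : H))

lemma commutator_eq_one_of_mem (H : Subgroup (Matrix.unitaryGroup ι ℂ)) [Finite H]
    {A B : Matrix.unitaryGroup ι ℂ} (hA : A ∈ H) (hB : B ∈ H) (hA1 : ‖A.1 - 1‖ < 1 / 4)
    (hB1 : ‖B.1 - 1‖ < 1 / 2) : ⁅A, B⁆ = 1 := by
  by_contra hAB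
  let S : Set (Matrix.unitaryGroup ι ℂ) := {X | X ∈ H ∧ ‖X.1 - 1‖ < 1 / 2 ∧ ⁅A, X⁆ ≠ 1}
  have hS : S.Finite := (Set.toFinite (H : Set (Matrix.unitaryGroup ι ℂ))).subset fun X hX => hX.1
  obtain ⟨X, ⟨hXH, hX1, hAX⟩, hmin⟩ :=
    Set.exists_min_image S (fun X => ‖X.1 - 1‖) hS ⟨B, hB, hB1, hAB⟩
  have hYH : ⁅A, X⁆ ∈ H := by
    rw [commutatorElement_def]
    exact H.mul_mem (H.mul_mem (H.mul_mem hA hXH) (H.inv_mem hA)) (H.inv_mem hXH)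
  have hXpos : 0 < ‖X.1 - 1‖ := by
    rw [norm_pos_iff, sub_ne_zero]
    intro h
    exact hAX (by rw [show X = 1 from Subtype.ext h, commutatorElement_one_right])
  have hlt : ‖(⁅A, X⁆).1 - 1‖ < ‖X.1 - 1‖ := by
    nlinarith [norm_commutator_le A X]
  have hcomm : ⁅A, ⁅A, X⁆⁆ = 1 := by
    by_contra h
    exact (hmin _ ⟨hYH, hlt.trans hX1, h⟩).not_gt hlt
  refine hAX (commutator_eq_one hX1 ?_ (commutatorElement_eq_one_iff_commute.1 hcomm))
  exact isOfFinOrder_of_mem_finite H hYH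

lemma norm_unitary_eq (U : Matrix.unitaryGroup ι ℂ) : ‖U.1‖ = ‖(1 : Matrix ι ι ℂ)‖ := by
  rw [← norm_unitary_mul U 1, Matrix.mul_one]

/-- Jordan's theorem on finite linear groups. -/
lemma exists_jordan_bound (Γ : Type*) [Group Γ] (ι : Type*) [Fintype ι] [DecidableEq ι] :
    ∃ k : ℕ, ∀ π : Γ →* Matrix.unitaryGroup ι ℂ, Finite π.range →
      ∃ A : Subgroup Γ, A.index ≠ 0 ∧ A.index ≤ k ∧ ∀ x ∈ A, ∀ y ∈ A, Commute (π x) (π y) := by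
  have : ProperSpace (Matrix ι ι ℂ) := FiniteDimensional.proper ℂ _
  obtain ⟨t, ht, hcover⟩ := Metric.totallyBounded_iff.1
    (isCompact_closedBall (0 : Matrix ι ι ℂ) ‖(1 : Matrix ι ι ℂ)‖).totallyBounded
    (1 / 8) (by norm_num)
  have : Finite t := ht
  refine ⟨Nat.card t, fun π hπ => ?_⟩
  let S : Set (Matrix.unitaryGroup ι ℂ) := {X | X ∈ π.range ∧ ‖X.1 - 1‖ < 1 / 4}
  let A : Subgroup Γ := (Subgroup.closure S).comap π
  have hcell (g : Γ) : ∃ y : t, dist (π g).1 y < 1 / 8 := by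
    have hg : (π g).1 ∈ Metric.closedBall (0 : Matrix ι ι ℂ) ‖(1 : Matrix ι ι ℂ)‖ := by
      simp [norm_unitary_eq (π g)]
    simpa using hcover hg
  choose f hf using hcell
  have hinj : Function.Injective fun q : Γ ⧸ A => f q.out := by
    intro p q hpq
    rw [← p.out_eq', ← q.out_eq']
    refine QuotientGroup.eq.2 (Subgroup.subset_closure ⟨⟨_, rfl⟩, ?_⟩)
    rw [← norm_unitary_mul (π p.out), Matrix.mul_sub, ← Submonoid.coe_mul, ← map_mul,
      mul_inv_cancel_left, Matrix.mul_one, ← dist_eq_norm]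
    have h1 := hf p.out
    have h2 := hf q.out
    rw [show f p.out = f q.out from hpq] at h1
    linarith [dist_triangle_right (π q.out).1 (π p.out).1 (f q.out)]
  have : Finite (Γ ⧸ A) := Finite.of_injective _ hinj
  refine ⟨A, A.index_ne_zero_of_finite, Nat.card_le_card_of_injective _ hinj, ?_⟩
  intro x hx y hy
  have hS : Subgroup.closure S ≤ Subgroup.centralizer S := by
    rw [Subgroup.closure_le]
    rintro X ⟨hX, hX1⟩ Y ⟨hY, hY1⟩
    exact commutatorElement_eq_one_iff_mul_comm.1
      (commutator_eq_one_of_mem π.range hY hX hY1 (by linarith))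
  exact (Subgroup.closure_le_centralizer_centralizer S hx (π y) (hS hy)).symm

end Jordan

section Residual

/-- An isometry onto a subspace of `ℂⁿ`, as a matrix. -/
lemma exists_isometry (n : ℕ) (W : Submodule ℂ (Fin n → ℂ)) :
    ∃ J : Matrix (Fin n) (Fin (Module.finrank ℂ W)) ℂ,
      Jᴴ * J = 1 ∧ (∀ v, J *ᵥ v ∈ W) ∧ ∀ w ∈ W, J *ᵥ (Jᴴ *ᵥ w) = w := by
  let L := WithLp.linearEquiv 2 ℂ (Fin n → ℂ)
  let V : Submodule ℂ (EuclideanSpace ℂ (Fin n)) := W.comap L.toLinearMap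
  have hV : Module.finrank ℂ V = Module.finrank ℂ W :=
    (L.ofSubmodule' W).finrank_eq
  let b := (stdOrthonormalBasis ℂ V).reindex (finCongr hV)
  let J : Matrix (Fin n) (Fin (Module.finrank ℂ W)) ℂ := Matrix.of fun i j => (b j).1 i
  have hJ (v) : J *ᵥ v = ∑ j, v j • L (b j).1 := by
    ext i
    simp [Matrix.mulVec, dotProduct, J, L, mul_comm]
  have hmem (v) : J *ᵥ v ∈ W := by
    rw [hJ]
    exact W.sum_mem fun j _ => W.smul_mem _ (b j).2
  have hJJ : Jᴴ * J = 1 := by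
    ext i j
    have := orthonormal_iff_ite.1 b.orthonormal i j
    rw [Submodule.coe_inner, PiLp.inner_apply] at this
    simpa [Matrix.mul_apply, Matrix.one_apply, J, mul_comm] using this
  refine ⟨J, hJJ, hmem, fun w hw => ?_⟩
  obtain ⟨v, rfl⟩ : ∃ v, J *ᵥ v = w := by
    refine ⟨b.repr ⟨L.symm w, hw⟩, ?_⟩
    have := congrArg (fun x : V => L x.1) (b.sum_repr ⟨L.symm w, hw⟩)
    rw [hJ]
    simpa using this
  rw [Matrix.mulVec_mulVec v, hJJ, Matrix.one_mulVec]

variable {Γ : Type*} [Group Γ]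

/-- Restriction of a unitary representation to an invariant subspace. -/
lemma exists_restriction {n : ℕ} (π : Γ →* Matrix.unitaryGroup (Fin n) ℂ)
    (W : Submodule ℂ (Fin n → ℂ)) (hW : ∀ g, ∀ v ∈ W, (π g).1 *ᵥ v ∈ W) :
    ∃ ρ : Γ →* Matrix.unitaryGroup (Fin (Module.finrank ℂ W)) ℂ,
      π.ker ≤ ρ.ker ∧ ∀ g, ρ g = 1 → ∀ w ∈ W, (π g).1 *ᵥ w = w := by
  obtain ⟨J, hJ, hJW, hWJ⟩ := exists_isometry n W
  have hinv (g : Γ) : J * (Jᴴ * ((π g).1 * J)) = (π g).1 * J := by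
    refine Matrix.ext_of_mulVec_single fun i => ?_
    simp only [← Matrix.mulVec_mulVec]
    exact hWJ _ (hW g _ (hJW _))
  let r (g : Γ) : Matrix (Fin (Module.finrank ℂ W)) (Fin (Module.finrank ℂ W)) ℂ :=
    Jᴴ * ((π g).1 * J)
  have hr1 : r 1 = 1 := by simp [r, hJ]
  have hmul (g h : Γ) : r (g * h) = r g * r h := by
    simp only [r, Matrix.mul_assoc, map_mul, Submonoid.coe_mul, hinv]
  have hstar (g : Γ) : (r g)ᴴ = r g⁻¹ := by
    simp only [r, Matrix.conjTranspose_mul, Matrix.conjTranspose_conjTranspose, Matrix.mul_assoc,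
      map_inv]
    rfl
  have hU (g : Γ) : r g ∈ Matrix.unitaryGroup (Fin (Module.finrank ℂ W)) ℂ := by
    rw [Matrix.mem_unitaryGroup_iff, Matrix.star_eq_conjTranspose, hstar, ← hmul, mul_inv_cancel,
      hr1]
  refine ⟨⟨⟨fun g => ⟨r g, hU g⟩, Subtype.ext hr1⟩, fun g h => Subtype.ext (hmul g h)⟩, ?_, ?_⟩
  · intro g hg
    refine Subtype.ext ?_
    change r g = 1
    rw [← hr1]
    simp only [r, map_one, MonoidHom.mem_ker.1 hg]
  · intro g hg w hw
    have hg1 : r g = 1 := congrArg Subtype.val hg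
    have hgJ : (π g).1 * J = J := by
      rw [← hinv g]
      change J * r g = J
      rw [hg1, Matrix.mul_one]
    rw [← hWJ w hw, Matrix.mulVec_mulVec, hgJ]

lemma exists_permHom (A : Subgroup Γ) [A.FiniteIndex] :
    ∃ f : Γ →* Equiv.Perm (Fin A.index), f.ker = A.normalCore := by
  let e : Γ ⧸ A ≃ Fin A.index := Finite.equivFin _
  refine ⟨e.permCongrHom.toMonoidHom.comp (MulAction.toPermHom Γ (Γ ⧸ A)), ?_⟩
  rw [Subgroup.normalCore_eq_ker]
  ext g
  exact map_eq_one_iff e.permCongrHom e.permCongrHom.injective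

lemma exists_rep_ker_eq (N : Subgroup Γ) [N.Normal] [N.FiniteIndex] :
    ∃ π : Γ →* Matrix.unitaryGroup (Fin N.index) ℂ, π.ker = N := by
  obtain ⟨f, hf⟩ := exists_permHom N
  let p : Equiv.Perm (Fin N.index) →* Matrix.unitaryGroup (Fin N.index) ℂ :=
    (Matrix.permMatrixHom (R := ℂ)).codRestrict _ fun σ => by
      rw [Matrix.mem_unitaryGroup_iff, Matrix.star_eq_conjTranspose]
      change σ⁻¹.permMatrix ℂ * (σ⁻¹.permMatrix ℂ)ᴴ = 1
      rw [Matrix.conjTranspose_permMatrix, ← Matrix.permMatrix_mul, inv_mul_cancel,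
        Matrix.permMatrix_one]
  have hp : Function.Injective p := fun σ τ h => by
    refine inv_injective (Equiv.ext fun i => ?_)
    have := congrArg (fun U => (Subtype.val U *ᵥ fun j => ((j : ℕ) : ℂ)) i) h
    change (σ⁻¹.permMatrix ℂ *ᵥ _) i = (τ⁻¹.permMatrix ℂ *ᵥ _) i at this
    simpa only [Matrix.permMatrix_mulVec, Function.comp_apply, Nat.cast_inj, Fin.val_inj] using this
  refine ⟨p.comp f, ?_⟩
  rw [MonoidHom.ker_comp_of_injective _ _ hp, hf, Subgroup.normalCore_eq_self]

/-- A finite quotient detecting `c` has an irreducible representation detecting `c`. -/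
lemma exists_irreducible (N : Subgroup Γ) [N.Normal] [N.FiniteIndex] {c : Γ} (hc : c ∉ N) :
    ∃ (n : ℕ) (π : Γ →* Matrix.unitaryGroup (Fin n) ℂ),
      IsIrreducibleRep π ∧ N ≤ π.ker ∧ π c ≠ 1 := by
  classical
  have hex : ∃ n, ∃ π : Γ →* Matrix.unitaryGroup (Fin n) ℂ, N ≤ π.ker ∧ π c ≠ 1 := by
    obtain ⟨π, hπ⟩ := exists_rep_ker_eq N
    exact ⟨_, π, hπ.ge, fun h => hc (hπ.le h)⟩
  obtain ⟨π, hN, hπc⟩ := Nat.find_spec hex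
  refine ⟨_, π, fun W hW => ?_, hN, hπc⟩
  by_contra! hne
  have htriv (V : Submodule ℂ (Fin (Nat.find hex) → ℂ)) (hV : V ≠ ⊤)
      (hinv : ∀ g, ∀ v ∈ V, (π g).1 *ᵥ v ∈ V) : ∀ v ∈ V, (π c).1 *ᵥ v = v := by
    obtain ⟨ρ, hker, hρ⟩ := exists_restriction π V hinv
    refine hρ c ?_
    by_contra h
    refine Nat.find_min hex ?_ ⟨ρ, hN.trans hker, h⟩
    simpa using Submodule.finrank_lt hV
  obtain ⟨J, hJ, hJW, hWJ⟩ := exists_isometry _ W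
  have hJker (v) : v ∈ LinearMap.ker Jᴴ.mulVecLin ↔ Jᴴ *ᵥ v = 0 := Iff.rfl
  have hbot : LinearMap.ker Jᴴ.mulVecLin ≠ ⊤ := fun h => hne.1 <| (Submodule.eq_bot_iff _).2
    fun w hw => by
      rw [← hWJ w hw, (hJker w).1 (h ▸ Submodule.mem_top), Matrix.mulVec_zero]
  have hinv (g : Γ) : J * (Jᴴ * ((π g⁻¹).1 * J)) = (π g⁻¹).1 * J := by
    refine Matrix.ext_of_mulVec_single fun i => ?_
    simp only [← Matrix.mulVec_mulVec]
    exact hWJ _ (hW g⁻¹ _ (hJW _))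
  have hinv' (g : Γ) : Jᴴ * (π g).1 = Jᴴ * (π g).1 * J * Jᴴ := by
    have := congrArg Matrix.conjTranspose (hinv g)
    have hstar : ((π g⁻¹).1)ᴴ = (π g).1 := by
      rw [map_inv]
      exact star_star (π g).1
    simp only [Matrix.conjTranspose_mul, Matrix.conjTranspose_conjTranspose, hstar] at this
    exact this.symm
  refine hπc (Subtype.ext (Matrix.ext_of_mulVec_single fun i => ?_))
  have h1 := htriv W hne.2 hW
  have h2 := htriv _ hbot fun g v hv => by
    rw [hJker] at hv ⊢
    rw [Matrix.mulVec_mulVec, hinv', ← Matrix.mulVec_mulVec, hv, Matrix.mulVec_zero]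
  generalize (Pi.single i 1 : Fin (Nat.find hex) → ℂ) = v
  have h3 := h2 (v - J *ᵥ (Jᴴ *ᵥ v)) (by
    rw [hJker, Matrix.mulVec_sub, Matrix.mulVec_mulVec _ Jᴴ J, hJ, Matrix.one_mulVec, sub_self])
  rw [Matrix.mulVec_sub, h1 _ (hJW _), sub_left_inj] at h3
  rw [h3]
  exact (Matrix.one_mulVec v).symm

/-- In a finitely generated group the subgroups of index at most `k` share a finite index
subgroup. -/
lemma exists_finiteIndex_le (hfg : Group.FG Γ) (k : ℕ) :
    ∃ K : Subgroup Γ, K.FiniteIndex ∧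
      ∀ A : Subgroup Γ, A.index ≠ 0 → A.index ≤ k → K ≤ A := by
  obtain ⟨S, hS⟩ := hfg.out
  have (j : Fin (k + 1)) : Finite (Γ →* Equiv.Perm (Fin j)) := by
    refine Finite.of_injective (fun f (s : S) => f s) fun f g hfg => ?_
    exact MonoidHom.eq_of_eqOn_dense hS fun s hs => congrFun hfg ⟨s, hs⟩
  refine ⟨⨅ i : Σ j : Fin (k + 1), (Γ →* Equiv.Perm (Fin j)), i.2.ker,
    Subgroup.finiteIndex_iInf fun i => Subgroup.finiteIndex_ker _, fun A hA0 hAk => ?_⟩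
  have : A.FiniteIndex := ⟨hA0⟩
  obtain ⟨f, hf⟩ := exists_permHom A
  exact (iInf_le (fun i : Σ j : Fin (k + 1), (Γ →* Equiv.Perm (Fin j)) => i.2.ker)
    ⟨⟨A.index, Nat.lt_succ_of_le hAk⟩, f⟩).trans (hf.trans_le A.normalCore_le)

end Residual

end HSStability

open HSStability in
/-- If a finitely generated residually finite group is uniformly HS stable,
then it is virtually abelian. -/
theorem stmt_13 (Γ : Type*) [Group Γ] (hfg : Group.FG Γ) (hrf : ResiduallyFinite Γ)
    (hstab : UniformlyHSStable Γ) :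
    VirtuallyAbelian Γ := by
  obtain ⟨D, hD⟩ := exists_dim_bound hstab
  choose k hk using fun n => exists_jordan_bound Γ (Fin n)
  obtain ⟨K, hK, hKA⟩ := exists_finiteIndex_le hfg ((Finset.range (D + 1)).sup k)
  refine ⟨K, hK, fun x hx y hy => ?_⟩
  by_contra hxy
  obtain ⟨N, hN, hNfin, hcN⟩ := hrf (x * y * (y * x)⁻¹) (by rwa [ne_eq, mul_inv_eq_one])
  obtain ⟨n, π, hirr, hker, hc⟩ := exists_irreducible N hcN
  have hfin : Finite π.range := by
    have : π.ker.FiniteIndex := Subgroup.finiteIndex_of_le hker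
    exact Nat.finite_of_card_ne_zero (Subgroup.index_ker π ▸ this.index_ne_zero)
  obtain ⟨A, hA0, hAk, hA⟩ := hk n π hfin
  have hle : K ≤ A := hKA A hA0 (hAk.trans
    (Finset.le_sup (Finset.mem_range.2 (Nat.lt_succ_of_le (hD n π hirr)))))
  apply hc
  rw [map_mul, map_inv, map_mul, map_mul, mul_inv_eq_one]
  exact hA x (hle hx) y (hle hy)
end
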